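/- arXiv:1407.4091 — 3 statements merged into one kernel-verified Lean document; each statement's English description precedes it below -/
import Mathlib

section
/- Let $C_1, C_2 \colon [0,1] \to \mathbb{R}^d$ be convex curves with opposite orientations (i.e. the orientation of $C_1$ is positive and that of $C_2$ is negative, or vice versa). Then there exists an affine hyperplane $H \subset \mathbb{R}^d$ such that for every $t \in [0,1]$, the points $C_1(t)$ and $C_2(t)$ are not both contained in the same open halfspace bounded by $H$. -/
open Set

/-- Determinant of the (d+1)×(d+1) matrix whose i-th column is the point `a i ∈ ℝ^d`
augmented by a final coordinate equal to 1. -/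
noncomputable def liftDet {d : ℕ} (a : Fin (d + 1) → (Fin d → ℝ)) : ℝ :=
  (Matrix.of fun j i : Fin (d + 1) =>
    Fin.lastCases (1 : ℝ) (fun j' => a i j') j).det

/-- An affine hyperplane in ℝ^d, given as the zero set of a non-trivial affine functional. -/
def IsAffHyperplane {d : ℕ} (H : Set (Fin d → ℝ)) : Prop :=
  ∃ (u : Fin d → ℝ) (c : ℝ), u ≠ 0 ∧ H = {x | ∑ j, u j * x j = c}

/-- A convex curve in ℝ^d: continuous on [0,1] and meets every affine hyperplane
in at most d parameter values. -/
def IsConvexCurve {d : ℕ} (C : ℝ → (Fin d → ℝ)) : Prop :=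
  ContinuousOn C (Icc 0 1) ∧
  ∀ H : Set (Fin d → ℝ), IsAffHyperplane H →
    {t ∈ Icc (0 : ℝ) 1 | C t ∈ H}.encard ≤ (d : ℕ∞)

def PosOriented {d : ℕ} (C : ℝ → (Fin d → ℝ)) : Prop :=
  ∀ t : Fin (d + 1) → ℝ, StrictMono t → (∀ i, t i ∈ Icc (0 : ℝ) 1) →
    0 < liftDet (fun i => C (t i))

def NegOriented {d : ℕ} (C : ℝ → (Fin d → ℝ)) : Prop :=
  ∀ t : Fin (d + 1) → ℝ, StrictMono t → (∀ i, t i ∈ Icc (0 : ℝ) 1) →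
    liftDet (fun i => C (t i)) < 0

def OrderTypeReversingOn {d : ℕ} (γ : (Fin d → ℝ) → (Fin d → ℝ))
    (A : Set (Fin d → ℝ)) : Prop :=
  ∀ a : Fin (d + 1) → (Fin d → ℝ), (∀ i, a i ∈ A) → Function.Injective a →
    Real.sign (liftDet a) = - Real.sign (liftDet (γ ∘ a))


theorem exists_det_one_add_eq_sum (E : Type*) [NormedAddCommGroup E] [NormedSpace ℝ E]
    [FiniteDimensional ℝ E] {r : ℝ} (hr : 0 < r) :
    ∃ (s c : Fin (Module.finrank ℝ E + 1) → ℝ), (∀ j, 0 < s j ∧ s j < r) ∧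
      ∀ M : E →L[ℝ] E, (1 + M).det = ∑ j, c j * (1 + s j • M).det := by
  set n := Module.finrank ℝ E
  let s : Fin (n + 1) → ℝ := fun j => r * ((j : ℝ) + 1) / (n + 2)
  have hs : Function.Injective s := fun i j hij => by
    have : r * ((i : ℝ) + 1) = r * ((j : ℝ) + 1) := by
      have hn : (n : ℝ) + 2 ≠ 0 := by positivity
      simpa [s, div_left_inj' hn] using hij
    have h := mul_left_cancel₀ hr.ne' this
    exact Fin.ext (by exact_mod_cast add_right_cancel h)
  refine ⟨s, fun j => (Lagrange.basis Finset.univ s j).eval 1, fun j => ⟨by positivity, ?_⟩,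
    fun M => ?_⟩
  · rw [div_lt_iff₀ (by positivity)]
    have : (j : ℝ) < n + 1 := by exact_mod_cast j.2
    exact mul_lt_mul_of_pos_left (by linarith) hr
  · let b := Module.finBasis ℝ E
    let A := LinearMap.toMatrix b b (M : E →ₗ[ℝ] E)
    let p : Polynomial ℝ := ((Polynomial.X : Polynomial ℝ) • A.map Polynomial.C +
      (1 : Matrix (Fin n) (Fin n) ℝ).map Polynomial.C).det
    have hp : ∀ t : ℝ, p.eval t = (1 + t • M).det := fun t => by
      rw [ContinuousLinearMap.det, ← LinearMap.det_toMatrix b]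
      simp only [p, ← Polynomial.coe_evalRingHom, RingHom.map_det]
      congr 1
      ext i j
      simp [A, LinearMap.toMatrix_apply, Matrix.one_apply, Finsupp.single_apply, eq_comm]
      split_ifs <;> simp [mul_comm, add_comm]
    have hdeg : p.degree < (Finset.univ : Finset (Fin (n + 1))).card := by
      refine Polynomial.degree_le_natDegree.trans_lt ?_
      have := Polynomial.natDegree_det_X_add_C_le A 1
      simp only [Fintype.card_fin] at this
      simp only [Finset.card_univ, Fintype.card_fin]
      exact_mod_cast Nat.lt_succ_of_le this
    have key := congrArg (Polynomial.eval 1) (Lagrange.eq_interpolate hs.injOn hdeg)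
    rw [hp, one_smul] at key
    rw [key, Lagrange.interpolate_apply, Polynomial.eval_finsetSum]
    refine Finset.sum_congr rfl fun j _ => ?_
    rw [Polynomial.eval_mul, Polynomial.eval_C, hp, mul_comm]

section
variable {E : Type*} [NormedAddCommGroup E] [NormedSpace ℝ E] [FiniteDimensional ℝ E]

theorem det_one_add_pos {M : E →L[ℝ] E} (hM : ‖M‖ < 1) : 0 < (1 + M).det := by
  have hne : ∀ t ∈ Icc (0 : ℝ) 1, (1 + t • M).det ≠ 0 := fun t ht h => by
    obtain ⟨x, hx, hx0⟩ := (Submodule.ne_bot_iff _).1 (LinearMap.det_eq_zero_iff_ker_ne_bot.1 h)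
    have hx' : x + t • M x = 0 := by simpa using hx
    have h1 : ‖x‖ = t * ‖M x‖ := by
      simpa [norm_smul, abs_of_nonneg ht.1] using
        congrArg norm (eq_neg_of_add_eq_zero_left hx')
    have h2 : ‖M x‖ ≤ ‖M‖ * ‖x‖ := M.le_opNorm x
    have h3 : 0 < ‖x‖ := norm_pos_iff.2 hx0
    nlinarith [ht.1, ht.2, norm_nonneg (M x), norm_nonneg M]
  have hcont : Continuous fun t : ℝ => (1 + t • M).det :=
    ContinuousLinearMap.continuous_det.comp (by fun_prop)
  by_contra hneg
  obtain ⟨t, ht, h⟩ := intermediate_value_Icc' (zero_le_one' ℝ) hcont.continuousOn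
    (show (0 : ℝ) ∈ _ by simpa [ContinuousLinearMap.det] using hneg)
  exact hne t ht h

open MeasureTheory Measure Metric NNReal

theorem bijective_add_smul {K : E → E} {C : ℝ≥0} (hK : LipschitzWith C K) {s : ℝ} (hs : 0 < s)
    (hsC : s * C < 1) : Function.Bijective fun x => x + s • K x := by
  have hc : ∀ y, ContractingWith (Real.toNNReal s * C) fun x => y - s • K x := fun y => by
    refine ⟨by rw [← NNReal.coe_lt_coe]; simpa [hs.le] using hsC,
      LipschitzWith.of_dist_le_mul fun a b => ?_⟩
    rw [dist_sub_left, dist_smul₀, NNReal.coe_mul, mul_assoc]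
    simp only [Real.norm_eq_abs, abs_of_pos hs, Real.coe_toNNReal s hs.le]
    gcongr
    exact hK.dist_le_mul a b
  refine ⟨fun a b hab => ?_, fun y => ?_⟩
  · have := (hc (a + s • K a)).fixedPoint_unique' (x := a) (y := b)
      (by simp [Function.IsFixedPt]) (by simp only [Function.IsFixedPt] at *; simp [hab])
    exact this
  · refine ⟨ContractingWith.fixedPoint _ (hc y), ?_⟩
    have := (hc y).fixedPoint_isFixedPt
    simp only [Function.IsFixedPt] at this
    exact (sub_eq_iff_eq_add.1 this).symm

theorem image_closedBall_add_smul {K : E → E} {C : ℝ≥0} (hK : LipschitzWith C K)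
    (h0 : ∀ x, 1 ≤ ‖x‖ → K x = 0) {s : ℝ} (hs : 0 < s) (hsC : s * C < 1) :
    (fun x => x + s • K x) '' closedBall 0 1 = closedBall 0 1 := by
  have hb := bijective_add_smul hK hs hsC
  have hfix : ∀ y ∉ closedBall (0 : E) 1, y + s • K y = y := fun y hy => by
    rw [h0 y (by simpa using (not_le.1 fun h => hy (by simpa using h)).le), smul_zero, add_zero]
  ext y
  constructor
  · rintro ⟨x, hx, rfl⟩
    by_contra hy
    have := hb.1 (hfix _ hy)
    exact hy (this.symm ▸ hx)
  · intro hy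
    obtain ⟨x, rfl⟩ := hb.2 y
    refine ⟨x, ?_, rfl⟩
    by_contra hx
    simp only [hfix x hx] at hy
    exact hx hy

variable [MeasurableSpace E] [BorelSpace E]

theorem lintegral_det_one_add_smul_fderiv {K : E → E} {C : ℝ≥0} (hK : LipschitzWith C K)
    (h0 : ∀ x, 1 ≤ ‖x‖ → K x = 0) {s : ℝ} (hs : 0 < s) (hsC : s * C < 1) :
    ∫⁻ x in closedBall 0 1, ENNReal.ofReal (1 + s • fderiv ℝ K x).det ∂μH[Module.finrank ℝ E] =
      μH[Module.finrank ℝ E] (closedBall (0 : E) 1) := by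
  set μ : Measure E := μH[Module.finrank ℝ E]
  set D := {x | DifferentiableAt ℝ K x}
  have hD : μ Dᶜ = 0 := hK.ae_differentiableAt
  have hF : LipschitzWith (1 + ‖s‖₊ * C) fun x => x + s • K x :=
    LipschitzWith.id.add ((lipschitzWith_smul s).comp hK)
  have hder : ∀ x ∈ closedBall 0 1 ∩ D, HasFDerivWithinAt (fun x => x + s • K x)
      (1 + s • fderiv ℝ K x) (closedBall 0 1 ∩ D) x := fun x hx =>
    ((hasFDerivAt_id x).add (hx.2.hasFDerivAt.const_smul s)).hasFDerivWithinAt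
  have himg := lintegral_abs_det_fderiv_eq_addHaar_image μ
    (isClosed_closedBall.measurableSet.inter (measurableSet_of_differentiableAt ℝ K)) hder
    (bijective_add_smul hK hs hsC).1.injOn
  have hnull : μ ((fun x => x + s • K x) '' (closedBall 0 1 ∩ Dᶜ)) = 0 := by
    refine le_antisymm ((hF.hausdorffMeasure_image_le (by positivity) _).trans ?_) bot_le
    rw [measure_mono_null inter_subset_right hD, mul_zero]
  have hrestrict : μ.restrict (closedBall 0 1 ∩ D) = μ.restrict (closedBall 0 1) :=
    restrict_congr_set (inter_ae_eq_left_of_ae_eq_univ (by simpa [ae_eq_univ] using hD))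
  have hfull : μ ((fun x => x + s • K x) '' (closedBall 0 1 ∩ D)) = μ (closedBall 0 1) := by
    conv_rhs => rw [← image_closedBall_add_smul hK h0 hs hsC]
    conv_rhs => rw [← inter_union_compl (closedBall 0 1) D, image_union]
    exact le_antisymm (measure_mono subset_union_left)
      ((measure_union_le _ _).trans (by rw [hnull, add_zero]))
  rw [hrestrict, hfull] at himg
  rw [← himg]
  refine lintegral_congr fun x => ?_
  rw [abs_of_pos (det_one_add_pos ?_)]
  rw [norm_smul, Real.norm_eq_abs, abs_of_pos hs]
  exact (mul_le_mul_of_nonneg_left (norm_fderiv_le_of_lipschitz ℝ hK) hs.le).trans_lt hsC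

theorem integral_det_one_add_fderiv {K : E → E} {C : ℝ≥0} (hK : LipschitzWith C K)
    (h0 : ∀ x, 1 ≤ ‖x‖ → K x = 0) :
    ∫ x in closedBall 0 1, (1 + fderiv ℝ K x).det ∂μH[Module.finrank ℝ E] =
      μH[Module.finrank ℝ E].real (closedBall (0 : E) 1) := by
  set μ : Measure E := μH[Module.finrank ℝ E]
  obtain ⟨s, c, hs, hdet⟩ := exists_det_one_add_eq_sum E (r := 1 / (C + 1)) (by positivity)
  have hsC : ∀ j, s j * C < 1 := fun j => by
    have := (lt_div_iff₀ (by positivity)).1 (hs j).2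
    nlinarith [(hs j).1]
  have hpos : ∀ j x, 0 < (1 + s j • fderiv ℝ K x).det := fun j x => by
    refine det_one_add_pos ?_
    rw [norm_smul, Real.norm_eq_abs, abs_of_pos (hs j).1]
    exact (mul_le_mul_of_nonneg_left (norm_fderiv_le_of_lipschitz ℝ hK) (hs j).1.le).trans_lt
      (hsC j)
  have hfin : μ (closedBall 0 1) ≠ ⊤ := (isCompact_closedBall 0 1).measure_lt_top.ne
  have hmeas : ∀ j, Measurable fun x => (1 + s j • fderiv ℝ K x).det := fun j =>
    ContinuousLinearMap.continuous_det.measurable.comp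
      (((measurable_fderiv ℝ K).const_smul (s j)).const_add 1)
  have h_integrable : ∀ j, IntegrableOn (fun x => (1 + s j • fderiv ℝ K x).det) (closedBall 0 1) μ :=
    fun j => by
      refine ⟨(hmeas j).aestronglyMeasurable, ?_⟩
      rw [hasFiniteIntegral_iff_ofReal (.of_forall fun x => (hpos j x).le),
        lintegral_det_one_add_smul_fderiv hK h0 (hs j).1 (hsC j)]
      exact hfin.lt_top
  have hval : ∀ j, ∫ x in closedBall 0 1, (1 + s j • fderiv ℝ K x).det ∂μ =
      μ.real (closedBall 0 1) := fun j => by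
    rw [integral_eq_lintegral_of_nonneg_ae (.of_forall fun x => (hpos j x).le)
      (hmeas j).aestronglyMeasurable,
      lintegral_det_one_add_smul_fderiv hK h0 (hs j).1 (hsC j)]
    rfl
  have hc : ∑ j, c j = 1 := by
    have := hdet 0
    simpa [ContinuousLinearMap.det] using this.symm
  rw [integral_congr_ae (.of_forall fun x => hdet _),
    integral_finsetSum _ fun j _ => (h_integrable j).const_mul (c j)]
  simp_rw [integral_const_mul, hval, ← Finset.sum_mul, hc, one_mul]

end

section
variable {E : Type*} [NormedAddCommGroup E] [NormedSpace ℝ E]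

/-- The radial retraction of a normed space onto its closed unit ball. -/
noncomputable def unitBallRetraction (y : E) : E :=
  (max 1 ‖y‖)⁻¹ • y

theorem unitBallRetraction_of_norm_le {y : E} (hy : ‖y‖ ≤ 1) : unitBallRetraction y = y := by
  simp [unitBallRetraction, hy]

theorem norm_unitBallRetraction_of_one_le {y : E} (hy : 1 ≤ ‖y‖) : ‖unitBallRetraction y‖ = 1 := by
  rw [unitBallRetraction, max_eq_right hy, norm_smul, norm_inv, norm_norm,
    inv_mul_cancel₀ (by positivity)]

theorem norm_unitBallRetraction_le (y : E) : ‖unitBallRetraction y‖ ≤ 1 := by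
  rcases le_total ‖y‖ 1 with hy | hy
  · rwa [unitBallRetraction_of_norm_le hy]
  · exact (norm_unitBallRetraction_of_one_le hy).le

theorem unitBallRetraction_smul {y : E} (hy : ‖y‖ = 1) {r : ℝ} (hr : 1 ≤ r) :
    unitBallRetraction (r • y) = y := by
  have hr0 : 0 < r := by linarith
  rw [unitBallRetraction, norm_smul, hy, mul_one, Real.norm_eq_abs, abs_of_pos hr0,
    max_eq_right hr, inv_smul_smul₀ hr0.ne']

theorem lipschitzWith_unitBallRetraction : LipschitzWith 2 (unitBallRetraction : E → E) := by
  refine LipschitzWith.of_dist_le_mul fun a b => ?_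
  rw [dist_eq_norm, dist_eq_norm]
  set α := max 1 ‖a‖ with hα
  set β := max 1 ‖b‖ with hβ
  have hα1 : 1 ≤ α := le_max_left ..
  have hβ1 : 1 ≤ β := le_max_left ..
  have hbβ : ‖b‖ ≤ β := le_max_right ..
  have hab : |β - α| ≤ ‖a - b‖ := by
    rw [hα, hβ, norm_sub_rev]
    simpa only [max_comm (1 : ℝ)] using
      (abs_max_sub_max_le_abs _ _ _).trans (abs_norm_sub_norm_le b a)
  have hsplit : unitBallRetraction a - unitBallRetraction b =
      α⁻¹ • (a - b) + (α⁻¹ * (β - α) * β⁻¹) • b := by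
    have : α⁻¹ * (β - α) * β⁻¹ = α⁻¹ - β⁻¹ := by field_simp
    rw [this, unitBallRetraction, unitBallRetraction, smul_sub, sub_smul]
    abel
  have h1 : ‖α⁻¹ • (a - b)‖ ≤ ‖a - b‖ := by
    rw [norm_smul, norm_inv, Real.norm_eq_abs, abs_of_pos (by linarith)]
    exact mul_le_of_le_one_left (norm_nonneg _) (inv_le_one_of_one_le₀ hα1)
  have h2 : ‖(α⁻¹ * (β - α) * β⁻¹) • b‖ ≤ ‖a - b‖ := by
    rw [norm_smul, norm_mul, norm_mul, norm_inv, norm_inv, Real.norm_eq_abs, Real.norm_eq_abs,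
      Real.norm_eq_abs, abs_of_pos (by linarith : 0 < α), abs_of_pos (by linarith : 0 < β)]
    calc α⁻¹ * |β - α| * β⁻¹ * ‖b‖ = α⁻¹ * |β - α| * (β⁻¹ * ‖b‖) := by ring
      _ ≤ 1 * |β - α| * 1 := by
        gcongr
        · exact inv_le_one_of_one_le₀ hα1
        · exact inv_mul_le_one_of_le₀ hbβ (by linarith)
      _ ≤ ‖a - b‖ := by linarith
  rw [hsplit]
  refine (norm_add_le _ _).trans ?_
  push_cast
  linarith

end

section
open MeasureTheory Measure Metric NNReal Topology
variable {E : Type*} [NormedAddCommGroup E] [InnerProductSpace ℝ E] [FiniteDimensional ℝ E]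

theorem det_eq_zero_of_norm_eventually_eq_one {F : E → E} {L : E →L[ℝ] E} {x : E}
    (hF : HasFDerivAt F L x) (h1 : ∀ᶠ y in 𝓝 x, ‖F y‖ = 1) : L.det = 0 := by
  by_contra hdet
  have hsurj : Function.Surjective (L : E →ₗ[ℝ] E) :=
    (LinearMap.equivOfDetNeZero (L : E →ₗ[ℝ] E) hdet).surjective
  obtain ⟨v, hv⟩ := hsurj (F x)
  have hd := hF.norm_sq
  have hc : HasFDerivAt (fun y => ‖F y‖ ^ 2) (0 : E →L[ℝ] ℝ) x :=
    (hasFDerivAt_const (1 : ℝ) x).congr_of_eventuallyEq (h1.mono fun y hy => by simp [hy])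
  have := congrArg (fun T : E →L[ℝ] ℝ => T v) (hd.unique hc)
  have hv' : L v = F x := hv
  simp [hv', h1.self_of_nhds] at this

/-- A Lipschitz self-map of the unit ball which fixes the unit sphere, vanishes only at the origin,
and is linear near the origin, has a linear part of nonnegative determinant. -/
theorem det_nonneg_of_lipschitzOnWith [Nontrivial E] {P : E → E} {C : ℝ≥0}
    (hP : LipschitzOnWith C P (closedBall 0 1)) (hsphere : ∀ x, ‖x‖ = 1 → P x = x)
    (hzero : ∀ x, ‖x‖ ≤ 1 → x ≠ 0 → P x ≠ 0) {A : E →L[ℝ] E} {η : ℝ} (hη : 0 < η)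
    (hlin : ∀ x, ‖x‖ < η → P x = A x) : 0 ≤ A.det := by
  borelize E
  by_contra! hA
  set μ : Measure E := μH[Module.finrank ℝ E]
  obtain ⟨c, hc, hPc⟩ : ∃ c > 0, ∀ x, η ≤ ‖x‖ → ‖x‖ ≤ 1 → c ≤ ‖P x‖ := by
    have hcomp : IsCompact (closedBall (0 : E) 1 ∩ {x | η ≤ ‖x‖}) :=
      (isCompact_closedBall 0 1).inter_right (isClosed_le continuous_const continuous_norm)
    obtain ⟨c, hc, h⟩ := hcomp.exists_forall_le' (f := fun x => ‖P x‖) (a := 0)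
      (hP.continuousOn.mono inter_subset_left).norm fun x hx =>
        norm_pos_iff.2 (hzero x (by simpa using hx.1) (norm_pos_iff.1 (hη.trans_le hx.2)))
    exact ⟨c, hc, fun x hx hx1 => h x ⟨by simpa using hx1, hx⟩⟩
  set r : ℝ := 1 + 1 / c
  have hr1 : 1 ≤ r := by simp only [r]; linarith [one_div_pos.2 hc]
  have hrc : 1 < r * c := by simp only [r]; field_simp; linarith
  have hr0 : 0 < r := by linarith
  set K : E → E := fun x =>
    unitBallRetraction (r • P (unitBallRetraction x)) - unitBallRetraction x
  have hK : LipschitzWith (2 * (‖r‖₊ * (C * 2)) + 2) K := by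
    refine LipschitzWith.sub (lipschitzWith_unitBallRetraction.comp
      ((lipschitzWith_smul r).comp ?_)) lipschitzWith_unitBallRetraction
    rw [← lipschitzOnWith_univ]
    exact hP.comp lipschitzWith_unitBallRetraction.lipschitzOnWith fun x _ => by
      simpa using norm_unitBallRetraction_le x
  have hK0 : ∀ x, 1 ≤ ‖x‖ → K x = 0 := fun x hx => by
    have := norm_unitBallRetraction_of_one_le hx
    simp only [K, hsphere _ this, unitBallRetraction_smul this hr1, sub_self]
  have h_integral := integral_det_one_add_fderiv hK hK0
  have hvol : 0 < μ.real (closedBall (0 : E) 1) :=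
    ENNReal.toReal_pos (measure_closedBall_pos μ 0 one_pos).ne'
      (isCompact_closedBall 0 1).measure_lt_top.ne
  refine hvol.not_ge (h_integral ▸ integral_nonpos_of_ae ?_)
  have hrA : (r • A).det ≠ 0 := by
    simp [ContinuousLinearMap.det, LinearMap.det_smul, hr0.ne']
    exact hA.ne
  have hnull : ∀ᵐ x ∂μ, ‖r • A x‖ ≠ 1 := by
    have : μ ((r • A : E →L[ℝ] E) ⁻¹' sphere 0 1) = 0 := by
      have := addHaar_preimage_linearMap μ (f := ((r • A : E →L[ℝ] E) : E →ₗ[ℝ] E)) hrA (sphere 0 1)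
      rw [addHaar_sphere, mul_zero] at this
      exact this
    rw [ae_iff]
    convert this using 2
    ext x
    simp
  filter_upwards [ae_restrict_mem isClosed_closedBall.measurableSet,
    ae_restrict_of_ae hK.ae_differentiableAt, ae_restrict_of_ae hnull,
    ae_restrict_of_ae (measure_eq_zero_iff_ae_notMem.1 (addHaar_sphere μ (0 : E) 1))]
    with x hx1 hxd hxA hxs
  have hx : ‖x‖ < 1 := lt_of_le_of_ne (by simpa using hx1) (by simpa using hxs)
  have hball : ∀ᶠ y in 𝓝 x, ‖y‖ < 1 := continuous_norm.continuousAt.eventually_lt_const hx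
  have hF : ∀ᶠ y in 𝓝 x, y + K y = unitBallRetraction (r • P y) := hball.mono fun y hy => by
    simp [K, unitBallRetraction_of_norm_le hy.le]
  have hder : HasFDerivAt (fun y => y + K y) (1 + fderiv ℝ K x) x :=
    (hasFDerivAt_id x).add hxd.hasFDerivAt
  have hPx : ContinuousAt P x := hP.continuousOn.continuousAt
    (closedBall_mem_nhds_of_mem (by simpa using hx))
  simp only [Pi.zero_apply]
  rcases lt_or_ge 1 ‖r • P x‖ with h | h
  · refine (det_eq_zero_of_norm_eventually_eq_one hder ?_).le
    have : ∀ᶠ y in 𝓝 x, 1 < ‖r • P y‖ := (hPx.const_smul r).norm.eventually_const_lt h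
    filter_upwards [this, hF] with y hy hFy
    rw [hFy, norm_unitBallRetraction_of_one_le hy.le]
  · have hxη : ‖x‖ < η := by
      by_contra! hxη
      have := hPc x hxη hx.le
      rw [norm_smul, Real.norm_eq_abs, abs_of_pos hr0] at h
      nlinarith
    rw [hlin x hxη] at h
    have hlt : ‖(r • A) x‖ < 1 := lt_of_le_of_ne h hxA
    have h1 : ∀ᶠ y in 𝓝 x, ‖(r • A) y‖ < 1 :=
      (r • A).continuous.norm.continuousAt.eventually_lt_const hlt
    have h2 : ∀ᶠ y in 𝓝 x, ‖y‖ < η := continuous_norm.continuousAt.eventually_lt_const hxη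
    have h3 : HasFDerivAt (fun y => y + K y) (r • A) x :=
      (r • A).hasFDerivAt.congr_of_eventuallyEq <| by
        filter_upwards [h1, h2, hF] with y hy hyη hFy
        rw [hFy, hlin y hyη, ← _root_.smul_apply, unitBallRetraction_of_norm_le hy.le]
    rw [hder.unique h3]
    simp only [ContinuousLinearMap.det, ContinuousLinearMap.toLinearMap_smul, LinearMap.det_smul]
    exact mul_nonpos_of_nonneg_of_nonpos (by positivity) hA.le
end
section
open Matrix

theorem Matrix.det_mul_eq_sum_prod_mul_det {n ι R : Type*} [Fintype n] [DecidableEq n] [Fintype ι]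
    [DecidableEq ι] [CommRing R] (A : Matrix n ι R) (B : Matrix ι n R) :
    (A * B).det = ∑ φ : n → ι, (∏ a, A a (φ a)) * (B.submatrix φ id).det := by
  have hrow : A * B = fun a => ∑ i, A a i • B i := by
    ext a b
    simp [Matrix.mul_apply]
  change detRowAlternating (A * B) = _
  rw [hrow]
  erw [MultilinearMap.map_sum]
  refine Finset.sum_congr rfl fun φ _ => ?_
  erw [MultilinearMap.map_smul_univ]
  rfl

/-- The **Cauchy–Binet formula**, summed over all maps instead of over subsets. -/
theorem Matrix.factorial_mul_det_mul {n ι R : Type*} [Fintype n] [DecidableEq n] [Fintype ι]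
    [DecidableEq ι] [CommRing R] (A : Matrix n ι R) (B : Matrix ι n R) :
    ((Fintype.card n).factorial : R) * (A * B).det =
      ∑ φ : n → ι, (A.submatrix id φ).det * (B.submatrix φ id).det := by
  have hσ : ∀ σ : Equiv.Perm n, (A * B).det =
      ∑ φ : n → ι, (Equiv.Perm.sign σ * ∏ a, A a (φ (σ a))) * (B.submatrix φ id).det := fun σ => by
    rw [det_mul_eq_sum_prod_mul_det,
      ← (Equiv.arrowCongr σ.symm (Equiv.refl ι)).sum_comp]
    refine Finset.sum_congr rfl fun φ _ => ?_
    have : B.submatrix (Equiv.arrowCongr σ.symm (Equiv.refl ι) φ) id =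
        (B.submatrix φ id).submatrix σ id := rfl
    rw [this, det_permute]
    simp only [Equiv.arrowCongr_apply, Equiv.coe_refl, Function.comp_apply, id, Equiv.symm_symm]
    ring
  have hsum : ((Fintype.card n).factorial : R) * (A * B).det =
      ∑ _σ : Equiv.Perm n, (A * B).det := by
    simp [Fintype.card_perm]
  rw [hsum, Finset.sum_congr rfl fun σ _ => hσ σ, Finset.sum_comm]
  refine Finset.sum_congr rfl fun φ _ => ?_
  rw [← Finset.sum_mul, ← det_transpose (A.submatrix id φ), det_apply' (A.submatrix id φ)ᵀ]
  rfl

end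

section
open Metric RealInnerProductSpace
variable {ι : Type*} [Fintype ι] {n : ℕ}

/-- The operator `∑ i, D i • v i ⊗ w i`. -/
noncomputable def weightedRankOneSum (v w : ι → EuclideanSpace ℝ (Fin n)) (D : ι → ℝ) :
    EuclideanSpace ℝ (Fin n) →L[ℝ] EuclideanSpace ℝ (Fin n) :=
  ∑ i, D i • (innerSL ℝ (w i)).smulRight (v i)

theorem weightedRankOneSum_apply (v w : ι → EuclideanSpace ℝ (Fin n)) (D : ι → ℝ)
    (x : EuclideanSpace ℝ (Fin n)) :
    weightedRankOneSum v w D x = ∑ i, (D i * ⟪w i, x⟫) • v i := by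
  simp [weightedRankOneSum, mul_smul]

theorem det_weightedRankOneSum_neg {v w : ι → EuclideanSpace ℝ (Fin n)}
    (hle : ∀ φ : Fin n → ι,
      (Matrix.of fun j => (v (φ j)).ofLp).det * (Matrix.of fun j => (w (φ j)).ofLp).det ≤ 0)
    (hlt : ∃ φ : Fin n → ι,
      (Matrix.of fun j => (v (φ j)).ofLp).det * (Matrix.of fun j => (w (φ j)).ofLp).det < 0)
    {D : ι → ℝ} (hD : ∀ i, 0 < D i) : (weightedRankOneSum v w D).det < 0 := by
  classical
  let A : Matrix (Fin n) ι ℝ := Matrix.of fun a i => v i a * D i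
  let B : Matrix ι (Fin n) ℝ := Matrix.of fun i b => w i b
  have hdet : (weightedRankOneSum v w D).det = (A * B).det := by
    rw [ContinuousLinearMap.det, ← LinearMap.det_toMatrix (EuclideanSpace.basisFun (Fin n) ℝ).toBasis]
    congr 1
    ext a b
    simp [LinearMap.toMatrix_apply, weightedRankOneSum_apply, A, B, Matrix.mul_apply, mul_comm,
      mul_assoc, mul_left_comm, EuclideanSpace.inner_single_right]
  have hterm : ∀ φ : Fin n → ι, (A.submatrix id φ).det * (B.submatrix φ id).det =
      (∏ j, D (φ j)) * ((Matrix.of fun j => (v (φ j)).ofLp).det *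
        (Matrix.of fun j => (w (φ j)).ofLp).det) := fun φ => by
    have : A.submatrix id φ = Matrix.of fun a j => D (φ j) *
        (Matrix.of fun j => (v (φ j)).ofLp).transpose a j := by
      ext a j
      simp [A, mul_comm]
    rw [this, Matrix.det_mul_row, Matrix.det_transpose, mul_assoc]
    rfl
  have hprod : ∀ φ : Fin n → ι, 0 < ∏ j, D (φ j) := fun φ => Finset.prod_pos fun j _ => hD _
  have hsum := Matrix.factorial_mul_det_mul A B
  simp only [hterm] at hsum
  have hneg : ∑ φ : Fin n → ι, (∏ j, D (φ j)) * ((Matrix.of fun j => (v (φ j)).ofLp).det *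
      (Matrix.of fun j => (w (φ j)).ofLp).det) < 0 := by
    obtain ⟨φ, hφ⟩ := hlt
    exact Finset.sum_neg' (fun ψ _ => mul_nonpos_of_nonneg_of_nonpos (hprod ψ).le (hle ψ))
      ⟨φ, Finset.mem_univ _, mul_neg_of_pos_of_neg (hprod φ) hφ⟩
  rw [← hsum] at hneg
  rw [hdet]
  exact neg_of_mul_neg_right hneg (by positivity)

/-- Two finite vector configurations with opposite orientations are separated, index by index, by
a linear hyperplane. -/
theorem exists_inner_mul_inner_nonpos [NeZero n] {v w : ι → EuclideanSpace ℝ (Fin n)}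
    (hle : ∀ φ : Fin n → ι,
      (Matrix.of fun j => (v (φ j)).ofLp).det * (Matrix.of fun j => (w (φ j)).ofLp).det ≤ 0)
    (hlt : ∃ φ : Fin n → ι,
      (Matrix.of fun j => (v (φ j)).ofLp).det * (Matrix.of fun j => (w (φ j)).ofLp).det < 0) :
    ∃ u ≠ 0, ∀ i, ⟪v i, u⟫ * ⟪w i, u⟫ ≤ 0 := by
  by_contra! hno
  let E := EuclideanSpace ℝ (Fin n)
  let θ := Real.smoothTransition
  let q : E → ℝ := fun x => ∑ i, θ (⟪v i, x⟫ * ⟪w i, x⟫) * (⟪v i, x⟫ * ⟪w i, x⟫)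
  have hθ : ContDiff ℝ 1 θ := Real.smoothTransition.contDiff
  have hterm : ∀ a : ℝ, 0 ≤ θ a * a := fun a => by
    rcases le_or_gt a 0 with ha | ha
    · simp [θ, Real.smoothTransition.zero_of_nonpos ha]
    · exact mul_nonneg (Real.smoothTransition.nonneg a) ha.le
  have hq : ∀ x, x ≠ 0 → 0 < q x := fun x hx => by
    obtain ⟨i, hi⟩ := hno x hx
    exact Finset.sum_pos' (fun i _ => hterm _)
      ⟨i, Finset.mem_univ _, mul_pos (Real.smoothTransition.pos_of_pos hi) hi⟩
  have hqc : Continuous q := by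
    have := hθ.continuous
    fun_prop
  obtain ⟨N, hN0, hN⟩ : ∃ N : ℝ, 0 ≤ N ∧ ∀ x : E, ‖x‖ ≤ 1 → 1 / 2 < ‖x‖ ^ 2 →
      0 < ∑ i, ⟪v i, x⟫ * ⟪w i, x⟫ + N * q x := by
    have hcomp : IsCompact (closedBall (0 : E) 1 ∩ {x | 1 / 2 ≤ ‖x‖ ^ 2}) :=
      (isCompact_closedBall 0 1).inter_right (isClosed_le (by fun_prop) (by fun_prop))
    have hne : ∀ x : E, 1 / 2 ≤ ‖x‖ ^ 2 → x ≠ 0 := by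
      rintro x hx rfl
      norm_num at hx
    obtain ⟨C, hC⟩ := hcomp.exists_bound_of_continuousOn
      (f := fun x : E => (∑ i, ⟪v i, x⟫ * ⟪w i, x⟫) / q x)
      (ContinuousOn.div (by fun_prop) hqc.continuousOn fun x hx => (hq x (hne x hx.2)).ne')
    refine ⟨|C| + 1, by positivity, fun x hx1 hx2 => ?_⟩
    have hqx := hq x (hne x hx2.le)
    have := (abs_le.1 ((hC x ⟨by simpa using hx1, hx2.le⟩).trans (le_abs_self C))).1
    rw [le_div_iff₀ hqx] at this
    nlinarith
  let D : E → ι → ℝ := fun x i => 1 + N * (θ (4 * ‖x‖ ^ 2 - 1) * θ (⟪v i, x⟫ * ⟪w i, x⟫))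
  have hD : ∀ x i, 0 < D x i := fun x i => by
    have := mul_nonneg hN0 (mul_nonneg (Real.smoothTransition.nonneg (4 * ‖x‖ ^ 2 - 1))
      (Real.smoothTransition.nonneg (⟪v i, x⟫ * ⟪w i, x⟫)))
    simp only [D, θ]
    linarith
  have hG0 : ∀ x, x ≠ 0 → weightedRankOneSum v w (D x) x ≠ 0 := fun x hx h =>
    (det_weightedRankOneSum_neg hle hlt (hD x)).ne <| LinearMap.det_eq_zero_iff_ker_ne_bot.2 <|
      (Submodule.ne_bot_iff _).2 ⟨x, h, hx⟩
  let P : E → E := fun x => (1 - θ (2 * ‖x‖ ^ 2 - 1)) • weightedRankOneSum v w (D x) x +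
    θ (2 * ‖x‖ ^ 2 - 1) • x
  have hP : ContDiff ℝ 1 P := by
    simp only [P, D, weightedRankOneSum_apply]
    have hχ : ∀ a : ℝ, ContDiff ℝ 1 fun x : E => θ (a * ‖x‖ ^ 2 - 1) := fun a =>
      hθ.comp ((contDiff_const.mul (contDiff_norm_sq ℝ)).sub contDiff_const)
    have hin : ∀ y : E, ContDiff ℝ 1 fun x : E => ⟪y, x⟫ := fun y => (innerSL ℝ y).contDiff
    refine ((contDiff_const.sub (hχ 2)).smul (ContDiff.sum fun i _ => ?_)).add
      ((hχ 2).smul contDiff_id)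
    exact ((contDiff_const.add (contDiff_const.mul ((hχ 4).mul
      (hθ.comp ((hin _).mul (hin _)))))).mul (hin _)).smul contDiff_const
  obtain ⟨C, hC⟩ := hP.contDiffOn.exists_lipschitzOnWith one_ne_zero
    (convex_closedBall (0 : E) 1) (isCompact_closedBall 0 1)
  refine (det_weightedRankOneSum_neg hle hlt fun _ => one_pos).not_ge
    (det_nonneg_of_lipschitzOnWith hC (fun x hx => ?_) (fun x hx1 hx0 => ?_) one_half_pos
      fun x hx => ?_)
  · have : θ (2 * ‖x‖ ^ 2 - 1) = 1 :=
      Real.smoothTransition.one_of_one_le (by rw [hx]; norm_num)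
    simp [P, this]
  · rcases le_or_gt (‖x‖ ^ 2) (1 / 2) with h | h
    · have : θ (2 * ‖x‖ ^ 2 - 1) = 0 := Real.smoothTransition.zero_of_nonpos (by linarith)
      simpa [P, this] using hG0 x hx0
    · have h4 : θ (4 * ‖x‖ ^ 2 - 1) = 1 := Real.smoothTransition.one_of_one_le (by linarith)
      have hGx : 0 < ⟪weightedRankOneSum v w (D x) x, x⟫ := by
        convert hN x hx1 h using 1
        rw [weightedRankOneSum_apply, sum_inner, Finset.mul_sum, ← Finset.sum_add_distrib]
        refine Finset.sum_congr rfl fun i _ => ?_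
        rw [real_inner_smul_left]
        simp only [D, h4]
        ring
      have hxx : 0 < ⟪x, x⟫ := real_inner_self_pos.2 hx0
      have hPx : 0 < ⟪P x, x⟫ := by
        simp only [P, inner_add_left, real_inner_smul_left]
        have h0 : 0 ≤ θ (2 * ‖x‖ ^ 2 - 1) := Real.smoothTransition.nonneg _
        have h1 : θ (2 * ‖x‖ ^ 2 - 1) ≤ 1 := Real.smoothTransition.le_one _
        rcases h1.lt_or_eq with h1 | h1
        · exact add_pos_of_pos_of_nonneg (mul_pos (by linarith) hGx) (mul_nonneg h0 hxx.le)
        · rw [h1]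
          linarith
      intro hPx0
      simp [hPx0] at hPx
  · have hx2 : ‖x‖ ^ 2 ≤ 1 / 4 := by nlinarith [norm_nonneg x]
    have h2 : θ (2 * ‖x‖ ^ 2 - 1) = 0 := Real.smoothTransition.zero_of_nonpos (by linarith)
    have h4 : θ (4 * ‖x‖ ^ 2 - 1) = 0 := Real.smoothTransition.zero_of_nonpos (by linarith)
    simp [P, D, h2, h4]

end
section
open Metric RealInnerProductSpace
variable {d : ℕ}

/-- A point of `ℝ^d` augmented by a final coordinate equal to `1`. -/
noncomputable def liftPoint (x : Fin d → ℝ) : EuclideanSpace ℝ (Fin (d + 1)) :=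
  WithLp.toLp 2 fun j => Fin.lastCases (1 : ℝ) x j

theorem inner_liftPoint (x : Fin d → ℝ) (u : EuclideanSpace ℝ (Fin (d + 1))) :
    ⟪liftPoint x, u⟫ = ∑ j : Fin d, u j.castSucc * x j + u (Fin.last d) := by
  simp [PiLp.inner_apply, liftPoint, Fin.sum_univ_castSucc]

theorem det_liftPoint (a : Fin (d + 1) → Fin d → ℝ) :
    (Matrix.of fun j => (liftPoint (a j)).ofLp).det = liftDet a := by
  rw [← Matrix.det_transpose]
  rfl

theorem liftDet_comp_perm (a : Fin (d + 1) → Fin d → ℝ) (σ : Equiv.Perm (Fin (d + 1))) :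
    liftDet (a ∘ σ) = Equiv.Perm.sign σ * liftDet a := by
  rw [← det_liftPoint, ← det_liftPoint, ← Matrix.det_permute]
  rfl

theorem liftDet_mul_liftDet_neg {C₁ C₂ : ℝ → Fin d → ℝ}
    (hopp : (PosOriented C₁ ∧ NegOriented C₂) ∨ (NegOriented C₁ ∧ PosOriented C₂))
    {t : Fin (d + 1) → ℝ} (ht : Function.Injective t) (hmem : ∀ i, t i ∈ Icc (0 : ℝ) 1) :
    liftDet (C₁ ∘ t) * liftDet (C₂ ∘ t) < 0 := by
  set σ := Tuple.sort t
  have hmono : StrictMono (t ∘ σ) :=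
    (Tuple.monotone_sort t).strictMono_of_injective (ht.comp σ.injective)
  have hsorted : liftDet (C₁ ∘ (t ∘ σ)) * liftDet (C₂ ∘ (t ∘ σ)) < 0 := by
    rcases hopp with ⟨h₁, h₂⟩ | ⟨h₁, h₂⟩
    · exact mul_neg_of_pos_of_neg (h₁ _ hmono fun i => hmem _) (h₂ _ hmono fun i => hmem _)
    · exact mul_neg_of_neg_of_pos (h₁ _ hmono fun i => hmem _) (h₂ _ hmono fun i => hmem _)
  have hsq : ((Equiv.Perm.sign σ : ℤ) : ℝ) * (Equiv.Perm.sign σ : ℤ) = 1 := by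
    exact_mod_cast Int.units_coe_mul_self _
  rw [← Function.comp_assoc, ← Function.comp_assoc, liftDet_comp_perm, liftDet_comp_perm,
    mul_mul_mul_comm, hsq, one_mul] at hsorted
  exact hsorted

theorem exists_inner_liftPoint_mul_nonpos {C₁ C₂ : ℝ → Fin d → ℝ}
    (hopp : (PosOriented C₁ ∧ NegOriented C₂) ∨ (NegOriented C₁ ∧ PosOriented C₂)) :
    ∃ u ≠ 0, ∀ t ∈ Icc (0 : ℝ) 1, ⟪liftPoint (C₁ t), u⟫ * ⟪liftPoint (C₂ t), u⟫ ≤ 0 := by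
  classical
  by_contra! hno
  obtain ⟨T, hT⟩ := (isCompact_sphere (0 : EuclideanSpace ℝ (Fin (d + 1))) 1).elim_finite_subcover
    (fun t : Icc (0 : ℝ) 1 => {u | 0 < ⟪liftPoint (C₁ t), u⟫ * ⟪liftPoint (C₂ t), u⟫})
    (fun t => isOpen_lt continuous_const (by fun_prop)) fun u hu => by
      obtain ⟨t, ht, h⟩ := hno u (ne_zero_of_mem_unit_sphere ⟨u, hu⟩)
      exact mem_iUnion.2 ⟨⟨t, ht⟩, h⟩
  have : Infinite (Icc (0 : ℝ) 1) := (Icc_infinite zero_lt_one).to_subtype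
  obtain ⟨S, hTS, hS⟩ := Infinite.exists_superset_card_eq T (T.card + (d + 1)) (by omega)
  have hdet : ∀ φ : Fin (d + 1) → S, Function.Injective φ →
      (Matrix.of fun j => (liftPoint (C₁ (φ j))).ofLp).det *
        (Matrix.of fun j => (liftPoint (C₂ (φ j))).ofLp).det < 0 := fun φ hφ => by
    rw [det_liftPoint, det_liftPoint]
    exact liftDet_mul_liftDet_neg hopp (t := fun j => φ j)
      (Subtype.val_injective.comp (Subtype.val_injective.comp hφ)) fun j => (φ j).1.2
  obtain ⟨u, hu0, hu⟩ := exists_inner_mul_inner_nonpos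
    (v := fun t : S => liftPoint (C₁ t)) (w := fun t : S => liftPoint (C₂ t)) (fun φ => by
      by_cases hφ : Function.Injective φ
      · exact (hdet φ hφ).le
      · obtain ⟨i, j, hij, hne⟩ := Function.not_injective_iff.1 hφ
        rw [Matrix.det_zero_of_row_eq hne (by ext; simp [hij]), zero_mul]) (by
      obtain ⟨φ⟩ : Nonempty (Fin (d + 1) ↪ S) :=
        Function.Embedding.nonempty_of_card_le (by simp [hS])
      exact ⟨φ, hdet φ φ.injective⟩)
  have hnorm : ‖u‖⁻¹ • u ∈ sphere (0 : EuclideanSpace ℝ (Fin (d + 1))) 1 := by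
    simp [norm_smul, hu0]
  obtain ⟨t, htT, ht⟩ := mem_iUnion₂.1 (hT hnorm)
  simp only [mem_ofPred_eq, real_inner_smul_right] at ht
  have hle := hu ⟨t, hTS htT⟩
  have : 0 ≤ ‖u‖⁻¹ * ‖u‖⁻¹ := mul_self_nonneg _
  nlinarith

end

/-- **Cutting convex curves.** If `C₁` and `C₂` are convex curves in ℝ^d with opposite
orientations, then there is an affine hyperplane `{x | ∑ j, u j * x j = c}` such that for
every t ∈ [0,1] the points `C₁ t` and `C₂ t` are never both in the same open halfspace. -/
theorem cutting_convex_curves {d : ℕ} (C₁ C₂ : ℝ → (Fin d → ℝ))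
    (h₁ : IsConvexCurve C₁) (h₂ : IsConvexCurve C₂)
    (hopp : (PosOriented C₁ ∧ NegOriented C₂) ∨ (NegOriented C₁ ∧ PosOriented C₂)) :
    ∃ (u : Fin d → ℝ) (c : ℝ), u ≠ 0 ∧
      ∀ t ∈ Icc (0 : ℝ) 1,
        ¬((∑ j, u j * C₁ t j) < c ∧ (∑ j, u j * C₂ t j) < c) ∧
        ¬(c < (∑ j, u j * C₁ t j) ∧ c < (∑ j, u j * C₂ t j)) := by
  obtain ⟨w, hw0, hw⟩ := exists_inner_liftPoint_mul_nonpos hopp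
  simp only [inner_liftPoint] at hw
  refine ⟨fun j => w j.castSucc, -w (Fin.last d), fun hu => hw0 ?_, fun t ht => ⟨?_, ?_⟩⟩
  · have hj : ∀ j : Fin d, w j.castSucc = 0 := fun j => congrFun hu j
    have hlast := hw 0 ⟨le_rfl, zero_le_one⟩
    simp only [hj, zero_mul, Finset.sum_const_zero, zero_add] at hlast
    ext j
    refine Fin.lastCases ?_ (fun j => ?_) j
    · exact mul_self_eq_zero.1 (le_antisymm hlast (mul_self_nonneg _))
    · exact hj j
  · rintro ⟨h₁, h₂⟩
    exact (mul_pos_of_neg_of_neg (by linarith) (by linarith)).not_ge (hw t ht)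
  · rintro ⟨h₁, h₂⟩
    exact (mul_pos (by linarith) (by linarith)).not_ge (hw t ht)
end

section
/- Let $d$ be even and let $C_1, C_2 \colon [0,1] \to \mathbb{R}^d$ be closed convex curves with opposite orientations. Then there exists an affine hyperplane $H \subset \mathbb{R}^d$ such that for every $t \in [0,1]$, the points $C_1(t)$ and $C_2(t)$ are not both contained in the same open halfspace bounded by $H$. -/
open Set

/-- A closed convex curve in ℝ^d: continuous on [0,1], with C 0 = C 1, meeting every
affine hyperplane in at most d parameter values in [0,1). -/
def IsClosedConvexCurve {d : ℕ} (C : ℝ → (Fin d → ℝ)) : Prop :=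
  ContinuousOn C (Icc 0 1) ∧ C 0 = C 1 ∧
  ∀ H : Set (Fin d → ℝ), IsAffHyperplane H →
    {t ∈ Ico (0 : ℝ) 1 | C t ∈ H}.encard ≤ (d : ℕ∞)

def PosOrientedClosed {d : ℕ} (C : ℝ → (Fin d → ℝ)) : Prop :=
  ∀ t : Fin (d + 1) → ℝ, StrictMono t → (∀ i, t i ∈ Ico (0 : ℝ) 1) →
    0 < liftDet (fun i => C (t i))

def NegOrientedClosed {d : ℕ} (C : ℝ → (Fin d → ℝ)) : Prop :=
  ∀ t : Fin (d + 1) → ℝ, StrictMono t → (∀ i, t i ∈ Ico (0 : ℝ) 1) →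
    liftDet (fun i => C (t i)) < 0

section Degree
open MeasureTheory Module

/-- The determinant is a combination of the values of
`s ↦ det (1 + s L)` at arbitrarily small arguments. -/
theorem exists_det_eq_sum_det_one_add {E : Type*} [AddCommGroup E] [Module ℝ E]
    [FiniteDimensional ℝ E] [Nontrivial E] {s₀ : ℝ} (hs₀ : 0 < s₀) :
    ∃ (T : Finset ℝ) (c : ℝ → ℝ), (∀ s ∈ T, 0 < s ∧ s ≤ s₀) ∧
      ∀ L : E →ₗ[ℝ] E, L.det = ∑ s ∈ T, c s * ((1 + s • L).det - 1) := by
  classical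
  set D := finrank ℝ E with hD
  have hDpos : 0 < D := finrank_pos
  obtain ⟨T, hT, hcard⟩ := (Set.Ioc_infinite hs₀).exists_subset_card_eq (D + 1)
  refine ⟨T, fun s => (∏ j ∈ T.erase s, (s - j))⁻¹, fun s hs => hT hs, fun L => ?_⟩
  let b := finBasis ℝ E
  set M := LinearMap.toMatrix b b L with hM
  let P : Polynomial ℝ :=
    ((Polynomial.X : Polynomial ℝ) • M.map Polynomial.C +
      (1 : Matrix (Fin D) (Fin D) ℝ).map Polynomial.C).det
  have hPeval : ∀ s : ℝ, P.eval s = (1 + s • L).det := by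
    intro s
    rw [← LinearMap.det_toMatrix b, map_add, map_smul, ← hM]
    simp only [P]
    rw [← Polynomial.coe_evalRingHom, RingHom.map_det]
    congr 1
    ext i j
    by_cases hij : i = j <;> simp [LinearMap.toMatrix_one, hij] <;> ring
  have hPdeg : (P - 1).degree < (T.card : ℕ) := by
    rw [hcard]
    refine lt_of_le_of_lt Polynomial.degree_le_natDegree ?_
    have h1 : P.natDegree ≤ D := by
      simpa only [Fintype.card_fin] using Polynomial.natDegree_det_X_add_C_le M 1
    have h2 := Polynomial.natDegree_sub_le P 1
    simp only [Polynomial.natDegree_one] at h2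
    exact_mod_cast (by omega : (P - 1).natDegree < D + 1)
  have hcoeff := Lagrange.coeff_eq_sum (s := T) (v := id) Function.injective_id.injOn hPdeg
  have hlead : (P - 1).coeff (T.card - 1) = L.det := by
    have h1 : P.coeff D = M.det := by
      simpa only [Fintype.card_fin] using Polynomial.coeff_det_X_add_C_card M 1
    rw [hcard, Nat.add_sub_cancel, Polynomial.coeff_sub, h1, Polynomial.coeff_one,
      if_neg hDpos.ne', sub_zero, hM, LinearMap.det_toMatrix]
  rw [← hlead, hcoeff]
  refine Finset.sum_congr rfl fun s _ => ?_
  simp [hPeval, div_eq_inv_mul]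

variable {E : Type*} [NormedAddCommGroup E] [NormedSpace ℝ E] [FiniteDimensional ℝ E]
  [MeasurableSpace E] [BorelSpace E] (μ : Measure E) [μ.IsAddHaarMeasure]

/-- A small compactly supported perturbation of the identity preserves the total volume. -/
theorem setIntegral_det_fderiv_add_smul {k : E → E} (hk : ContDiff ℝ 1 k) {r : ℝ}
    (hr : tsupport k ⊆ Metric.closedBall 0 r) {K : NNReal} (hK : LipschitzWith K k) {s : ℝ}
    (hs : 0 ≤ s) (hsK : s * K < 1)
    (hdet : ∀ x, 0 < (1 + s • fderiv ℝ k x : E →L[ℝ] E).det) :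
    ∫ x in Metric.closedBall 0 r, (1 + s • fderiv ℝ k x : E →L[ℝ] E).det ∂μ =
      μ.real (Metric.closedBall 0 r) := by
  set B := Metric.closedBall (0 : E) r
  let φ : E → E := fun x => x + s • k x
  have hφ' : ∀ x, HasFDerivAt φ (1 + s • fderiv ℝ k x) x := fun x =>
    (hasFDerivAt_id x).add (((hk.differentiable one_ne_zero) x).hasFDerivAt.const_smul s)
  have happ : ApproximatesLinearOn φ ((ContinuousLinearEquiv.refl ℝ E : E ≃L[ℝ] E) : E →L[ℝ] E)
      univ (⟨s, hs⟩ * K) := by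
    rw [ApproximatesLinearOn.approximatesLinearOn_iff_lipschitzOnWith, lipschitzOnWith_univ]
    have : φ - ⇑((ContinuousLinearEquiv.refl ℝ E : E ≃L[ℝ] E) : E →L[ℝ] E) = fun x => s • k x := by
      ext x; simp [φ]
    rw [this]
    refine LipschitzWith.of_dist_le_mul fun x y => ?_
    rw [dist_smul₀, Real.norm_of_nonneg hs]
    exact (mul_le_mul_of_nonneg_left (hK.dist_le_mul x y) hs).trans_eq (mul_assoc _ _ _).symm
  have hc : Subsingleton E ∨ ⟨s, hs⟩ * K <
      ‖((ContinuousLinearEquiv.refl ℝ E).symm : E →L[ℝ] E)‖₊⁻¹ := by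
    rcases subsingleton_or_nontrivial E with h | h
    · exact Or.inl h
    · right
      have : ‖((ContinuousLinearEquiv.refl ℝ E).symm : E →L[ℝ] E)‖₊ = 1 := by
        ext; exact ContinuousLinearMap.norm_id
      rw [this, inv_one]
      exact_mod_cast hsK
  have hinj : Function.Injective φ := injOn_univ.1 (happ.injOn hc)
  have hsurj : Function.Surjective φ := happ.surjective hc
  have hout : ∀ x, x ∉ B → φ x = x := fun x hx => by
    have : k x = 0 := image_eq_zero_of_notMem_tsupport fun h => hx (hr h)
    simp [φ, this]
  have himg : φ '' B = B := by
    ext y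
    constructor
    · rintro ⟨x, hx, rfl⟩
      by_contra h
      have := hinj (hout _ h)
      exact h (by rwa [this])
    · intro hy
      obtain ⟨x, rfl⟩ := hsurj y
      refine ⟨x, ?_, rfl⟩
      by_contra h
      exact h (by rwa [hout x h] at hy)
  have hcov := integral_image_eq_integral_abs_det_fderiv_smul μ (s := B)
    Metric.isClosed_closedBall.measurableSet
    (fun x _ => (hφ' x).hasFDerivWithinAt) hinj.injOn (fun _ => (1 : ℝ))
  rw [himg] at hcov
  simp only [abs_of_pos (hdet _), smul_eq_mul, mul_one] at hcov
  rw [← hcov]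
  simp [Measure.real]

/-- The Jacobian determinant of a compactly supported map has integral zero. -/
theorem integral_det_fderiv_eq_zero [Nontrivial E] {k : E → E} (hk : ContDiff ℝ 1 k)
    (hsupp : HasCompactSupport k) : ∫ x, (fderiv ℝ k x).det ∂μ = 0 := by
  obtain ⟨r, hr⟩ := hsupp.isCompact.isBounded.subset_closedBall (0 : E)
  set B := Metric.closedBall (0 : E) r with hB
  obtain ⟨K, hK⟩ := hk.lipschitzWith_of_hasCompactSupport hsupp one_ne_zero
  have hnear : ∀ᶠ L in nhds (0 : E →L[ℝ] E), 0 < (1 + L).det := by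
    refine ((ContinuousLinearMap.continuous_det.comp
      (continuous_const.add continuous_id)).tendsto (0 : E →L[ℝ] E)).eventually
      (lt_mem_nhds ?_)
    have : (1 + 0 : E →L[ℝ] E).det = 1 := by
      simp [ContinuousLinearMap.det]
    change 0 < (1 + 0 : E →L[ℝ] E).det
    rw [this]
    exact one_pos
  obtain ⟨δ, hδ, hball⟩ := Metric.eventually_nhds_iff.1 hnear
  obtain ⟨s₀, hs₀, hs₀K, hs₀δ⟩ : ∃ s₀ : ℝ, 0 < s₀ ∧ s₀ * K < 1 ∧ s₀ * K < δ := by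
    refine ⟨min 1 δ / (K + 1), by positivity, ?_, ?_⟩ <;>
    · have h1 : (0 : ℝ) < K + 1 := by positivity
      have hm : 0 < min 1 δ := by positivity
      have : min 1 δ / (K + 1) * K < min 1 δ := by
        rw [div_mul_eq_mul_div, div_lt_iff₀ h1]
        nlinarith
      first
        | exact this.trans_le (min_le_left _ _)
        | exact this.trans_le (min_le_right _ _)
  obtain ⟨T, c, hT, hdet⟩ := exists_det_eq_sum_det_one_add (E := E) hs₀
  have hcont : Continuous (fderiv ℝ k) := hk.continuous_fderiv one_ne_zero
  have hzero : ∀ s ∈ T, ∫ x in B, ((1 + s • fderiv ℝ k x : E →L[ℝ] E).det - 1) ∂μ = 0 := by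
    intro s hs
    obtain ⟨hs1, hs2⟩ := hT s hs
    have hsK : s * K ≤ s₀ * K := mul_le_mul_of_nonneg_right hs2 K.2
    have hc : Continuous fun x => (1 + s • fderiv ℝ k x : E →L[ℝ] E).det :=
      ContinuousLinearMap.continuous_det.comp (continuous_const.add (hcont.const_smul s))
    rw [integral_sub (hc.continuousOn.integrableOn_compact (isCompact_closedBall _ _))
      (continuousOn_const.integrableOn_compact (isCompact_closedBall _ _)),
      setIntegral_det_fderiv_add_smul μ hk hr hK hs1.le (hsK.trans_lt hs₀K)]
    · simp [Measure.real]
    · intro x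
      apply hball
      rw [dist_zero_right, norm_smul, Real.norm_of_nonneg hs1.le]
      exact (mul_le_mul_of_nonneg_left (norm_fderiv_le_of_lipschitz ℝ hK) hs1.le).trans_lt
        (hsK.trans_lt hs₀δ)
  have hout : ∀ x, x ∉ B → (fderiv ℝ k x).det = 0 := fun x hx => by
    have : fderiv ℝ k x = 0 :=
      image_eq_zero_of_notMem_tsupport fun h => hx (hr (tsupport_fderiv_subset ℝ h))
    rw [this]
    simp [ContinuousLinearMap.det]
  rw [← setIntegral_eq_integral_of_forall_compl_eq_zero hout]
  have hrepr : ∀ x, (fderiv ℝ k x).det =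
      ∑ s ∈ T, c s * ((1 + s • fderiv ℝ k x : E →L[ℝ] E).det - 1) := fun x => hdet _
  simp_rw [hrepr]
  rw [integral_finsetSum]
  · exact Finset.sum_eq_zero fun s hs => by rw [integral_const_mul, hzero s hs, mul_zero]
  · intro s _
    refine Continuous.continuousOn ?_ |>.integrableOn_compact (isCompact_closedBall _ _)
    exact continuous_const.mul ((ContinuousLinearMap.continuous_det.comp
      (continuous_const.add (hcont.const_smul s))).sub continuous_const)

end Degree
section DegreeComparison
open MeasureTheory Filter Topology

theorem exists_deriv_smoothTransition_pos : ∃ u, 0 < deriv Real.smoothTransition u := by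
  have hdiff : Differentiable ℝ Real.smoothTransition :=
    (Real.smoothTransition.contDiff (n := 1)).differentiable one_ne_zero
  obtain ⟨u, -, hu⟩ := exists_deriv_eq_slope Real.smoothTransition zero_lt_one
    hdiff.continuous.continuousOn hdiff.differentiableOn
  exact ⟨u, by simp [hu]⟩

theorem deriv_smoothTransition_eq_zero {u : ℝ} (hu : 1 ≤ |u|) :
    deriv Real.smoothTransition u = 0 := by
  rcases le_abs'.1 hu with h | h
  · refine IsLocalMin.deriv_eq_zero (Eventually.of_forall fun v => ?_)
    rw [Real.smoothTransition.zero_of_nonpos (by linarith)]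
    exact Real.smoothTransition.nonneg v
  · refine IsLocalMax.deriv_eq_zero (Eventually.of_forall fun v => ?_)
    rw [Real.smoothTransition.one_of_one_le h]
    exact Real.smoothTransition.le_one v

variable {n : Type*} [Fintype n]

/-- The coordinatewise smooth step of width `m`. -/
noncomputable def smoothStep (m : ℝ) (y : n → ℝ) : n → ℝ :=
  fun i => Real.smoothTransition (y i / m)

/-- The Jacobian determinant of `smoothStep m`. -/
noncomputable def smoothStepJacobian (m : ℝ) (y : n → ℝ) : ℝ :=
  ∏ i, deriv Real.smoothTransition (y i / m) / m

theorem contDiff_smoothStep (m : ℝ) : ContDiff ℝ 1 (smoothStep m : (n → ℝ) → n → ℝ) :=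
  contDiff_pi.2 fun i =>
    (Real.smoothTransition.contDiff (n := 1)).comp ((contDiff_apply ℝ ℝ i).div_const m)

theorem smoothStepJacobian_nonneg {m : ℝ} (hm : 0 < m) (y : n → ℝ) :
    0 ≤ smoothStepJacobian m y :=
  Finset.prod_nonneg fun _ _ => div_nonneg (Real.smoothTransition.monotone.deriv_nonneg) hm.le

theorem smoothStepJacobian_eq_zero [Nonempty n] {m : ℝ} (hm : 0 < m) {y : n → ℝ} (hy : m ≤ ‖y‖) :
    smoothStepJacobian m y = 0 := by
  obtain ⟨i, hi⟩ : ∃ i, m ≤ |y i| := by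
    by_contra! h
    exact absurd ((pi_norm_lt_iff hm).2 h) (not_lt.2 hy)
  refine Finset.prod_eq_zero (Finset.mem_univ i) ?_
  rw [deriv_smoothTransition_eq_zero, zero_div]
  rwa [abs_div, abs_of_pos hm, one_le_div hm]

theorem det_fderiv_smoothStep_comp (m : ℝ) {G : (n → ℝ) → n → ℝ} {x : n → ℝ}
    (hG : DifferentiableAt ℝ G x) :
    (fderiv ℝ (fun y => smoothStep m (G y)) x).det =
      smoothStepJacobian m (G x) * (fderiv ℝ G x).det := by
  classical
  have hρ : HasFDerivAt (smoothStep m) (LinearMap.toContinuousLinearMap (Matrix.toLin'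
      (Matrix.diagonal fun i => deriv Real.smoothTransition (G x i / m) / m))) (G x) := by
    rw [hasFDerivAt_pi']
    intro i
    have h1 : HasDerivAt Real.smoothTransition
        (deriv Real.smoothTransition (G x i / m)) (G x i / m) :=
      ((Real.smoothTransition.contDiff (n := 1)).differentiable one_ne_zero _).hasDerivAt
    have h2 : HasFDerivAt (fun y : n → ℝ => y i / m)
        (m⁻¹ • ContinuousLinearMap.proj (R := ℝ) (φ := fun _ : n => ℝ) i) (G x) := by
      simp only [div_eq_inv_mul]
      exact (hasFDerivAt_apply (𝕜 := ℝ) i (G x)).const_smul m⁻¹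
    refine (h1.comp_hasFDerivAt (G x) h2).congr_fderiv (ContinuousLinearMap.ext fun v => ?_)
    change _ * (m⁻¹ * v i) = ((Matrix.diagonal _).mulVec v) i
    rw [Matrix.mulVec_diagonal]
    ring
  have := (hρ.comp x hG.hasFDerivAt).fderiv
  change fderiv ℝ (fun y => smoothStep m (G y)) x = _ at this
  rw [this]
  simp only [ContinuousLinearMap.det, ContinuousLinearMap.toLinearMap_comp, LinearMap.det_comp]
  congr 1
  rw [LinearMap.coe_toContinuousLinearMap, LinearMap.det_toLin', Matrix.det_diagonal]
  rfl

/-- A map without zeros away from the origin cannot agree with an orientation preserving linear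
map near infinity and with an orientation reversing one near the origin. -/
theorem not_det_neg_of_forall_ne_zero [Nonempty n] {A B : (n → ℝ) →L[ℝ] (n → ℝ)}
    {G : (n → ℝ) → n → ℝ} (hG : ContDiff ℝ 1 G) (hG0 : ∀ x, x ≠ 0 → G x ≠ 0)
    (hGA : G =ᶠ[cocompact (n → ℝ)] A) (hGB : G =ᶠ[𝓝 0] B) (hA : 0 < A.det) : ¬ B.det < 0 := by
  intro hB
  obtain ⟨R, hR, hRA⟩ : ∃ R : ℝ, 0 < R ∧ ∀ x, R < ‖x‖ → G x = A x := by
    obtain ⟨R, hR⟩ := Metric.closedBall_compl_subset_of_mem_cocompact hGA (0 : n → ℝ)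
    refine ⟨max R 1, by positivity, fun x hx => hR ?_⟩
    simpa using (le_max_left R 1).trans_lt hx
  obtain ⟨r, hr, hrB⟩ : ∃ r : ℝ, 0 < r ∧ ∀ x, ‖x‖ < r → G x = B x := by
    obtain ⟨r, hr, h⟩ := Metric.eventually_nhds_iff.1 hGB
    exact ⟨r, hr, fun x hx => h (by simpa using hx)⟩
  obtain ⟨m₁, hm₁, hm₁G⟩ : ∃ m₁ : ℝ, 0 < m₁ ∧ ∀ x, r ≤ ‖x‖ → ‖x‖ ≤ R → m₁ ≤ ‖G x‖ := by
    have hcomp : IsCompact (Metric.closedBall (0 : n → ℝ) R ∩ {x | r ≤ ‖x‖}) :=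
      (isCompact_closedBall _ _).inter_right (isClosed_le continuous_const continuous_norm)
    obtain ⟨m, hm, h⟩ := hcomp.exists_forall_le' (f := fun x => ‖G x‖) (a := 0)
      hG.continuous.norm.continuousOn fun x hx =>
        norm_pos_iff.2 (hG0 x (norm_pos_iff.1 (hr.trans_le hx.2)))
    exact ⟨m, hm, fun x h1 h2 => h x ⟨by simpa using h2, h1⟩⟩
  obtain ⟨u, hu⟩ := exists_deriv_smoothTransition_pos
  obtain ⟨z, hz⟩ : ∃ z, A z = fun _ => u :=
    ((LinearMap.equivOfDetNeZero (A : (n → ℝ) →ₗ[ℝ] (n → ℝ)) hA.ne').surjective fun _ => u)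
  obtain ⟨m, hm, hmm, hmz⟩ : ∃ m : ℝ, 0 < m ∧ m ≤ m₁ ∧ m * ‖z‖ ≤ R := by
    refine ⟨min m₁ (R / (‖z‖ + 1)), by positivity, min_le_left _ _, ?_⟩
    calc min m₁ (R / (‖z‖ + 1)) * ‖z‖ ≤ R / (‖z‖ + 1) * (‖z‖ + 1) := by
          gcongr
          · exact min_le_right _ _
          · linarith
      _ = R := by field_simp
  let χ : ContDiffBump (0 : n → ℝ) := ⟨R + 1, R + 2, by linarith, by linarith⟩
  have cutoff : ∀ {F : (n → ℝ) → n → ℝ}, ContDiff ℝ 1 F →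
      ContDiff ℝ 1 (fun x => χ x • smoothStep m (F x)) ∧
      HasCompactSupport (fun x => χ x • smoothStep m (F x)) ∧
      ∀ x, ‖x‖ ≤ R → (fderiv ℝ (fun x => χ x • smoothStep m (F x)) x).det =
        smoothStepJacobian m (F x) * (fderiv ℝ F x).det := by
    intro F hF
    refine ⟨χ.contDiff.smul ((contDiff_smoothStep m).comp hF), χ.hasCompactSupport.smul_right, ?_⟩
    intro x hx
    rw [← det_fderiv_smoothStep_comp m (hF.differentiable one_ne_zero x)]
    congr 1
    refine EventuallyEq.fderiv_eq ?_
    have hxb : x ∈ Metric.ball (0 : n → ℝ) χ.rIn := by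
      change x ∈ Metric.ball (0 : n → ℝ) (R + 1)
      simpa using (by linarith : ‖x‖ < R + 1)
    filter_upwards [χ.eventuallyEq_one_of_mem_ball hxb] with y hy
    simp [hy]
  obtain ⟨hkA, hsA, hdA⟩ := cutoff A.contDiff
  obtain ⟨hkG, hsG, hdG⟩ := cutoff hG
  set kA := fun x => χ x • smoothStep m (A x)
  set kG := fun x => χ x • smoothStep m (G x)
  let I : (n → ℝ) → ℝ := fun x => (fderiv ℝ kA x).det - (fderiv ℝ kG x).det
  have hdet0 : (0 : (n → ℝ) →L[ℝ] (n → ℝ)).det = 0 := by simp [ContinuousLinearMap.det]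
  have hcA : Continuous fun x => (fderiv ℝ kA x).det :=
    ContinuousLinearMap.continuous_det.comp (hkA.continuous_fderiv one_ne_zero)
  have hcG : Continuous fun x => (fderiv ℝ kG x).det :=
    ContinuousLinearMap.continuous_det.comp (hkG.continuous_fderiv one_ne_zero)
  have hsA' : HasCompactSupport fun x => (fderiv ℝ kA x).det :=
    (hsA.fderiv (𝕜 := ℝ)).comp_left (g := ContinuousLinearMap.det) hdet0
  have hsG' : HasCompactSupport fun x => (fderiv ℝ kG x).det :=
    (hsG.fderiv (𝕜 := ℝ)).comp_left (g := ContinuousLinearMap.det) hdet0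
  have hint : ∫ x, I x = 0 := by
    simp only [I]
    rw [integral_sub (hcA.integrable_of_hasCompactSupport hsA')
      (hcG.integrable_of_hasCompactSupport hsG'), integral_det_fderiv_eq_zero volume hkA hsA,
      integral_det_fderiv_eq_zero volume hkG hsG, sub_zero]
  have hdG_nonpos : ∀ x, ‖x‖ ≤ R → (fderiv ℝ kG x).det ≤ 0 := by
    intro x hx
    rw [hdG x hx]
    rcases lt_or_ge ‖x‖ r with h | h
    · have : fderiv ℝ G x = B := by
        rw [← B.fderiv (x := x)]
        refine EventuallyEq.fderiv_eq ?_
        filter_upwards [(isOpen_lt continuous_norm continuous_const).mem_nhds h] with y hy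
        exact hrB y hy
      rw [this]
      exact mul_nonpos_of_nonneg_of_nonpos (smoothStepJacobian_nonneg hm _) hB.le
    · rw [smoothStepJacobian_eq_zero hm (hmm.trans (hm₁G x h hx)), zero_mul]
  have hI : 0 ≤ I := by
    intro x
    rcases le_or_gt ‖x‖ R with h | h
    · have hAx : 0 ≤ (fderiv ℝ kA x).det := by
        rw [hdA x h, A.fderiv]
        exact mul_nonneg (smoothStepJacobian_nonneg hm _) hA.le
      exact sub_nonneg.2 ((hdG_nonpos x h).trans hAx)
    · have : fderiv ℝ kA x = fderiv ℝ kG x := by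
        refine EventuallyEq.fderiv_eq ?_
        filter_upwards [(isOpen_lt continuous_const continuous_norm).mem_nhds h] with y hy
        simp only [kA, kG, hRA y hy]
      simp [I, this]
  have hIpos : 0 < I (m • z) := by
    have hmzR : ‖m • z‖ ≤ R := by rwa [norm_smul, Real.norm_of_nonneg hm.le]
    refine sub_pos.2 ((hdG_nonpos _ hmzR).trans_lt ?_)
    rw [hdA _ hmzR, A.fderiv]
    refine mul_pos (Finset.prod_pos fun i _ => div_pos ?_ hm) hA
    simpa [hz, hm.ne'] using hu
  have := (hcA.sub hcG).integral_pos_of_hasCompactSupport_nonneg_nonzero (μ := volume)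
    (hsA'.sub hsG') hI (x := m • z) hIpos.ne'
  exact this.ne' hint

end DegreeComparison

section CauchyBinet
open Matrix

/-- Symmetrised Cauchy–Binet formula. -/
theorem factorial_mul_det_sum_vecMulVec {ι n : Type*} [Fintype ι] [Fintype n] [DecidableEq n]
    (w : ι → ℝ) (X Y : ι → n → ℝ) :
    ((Fintype.card n).factorial : ℝ) * (∑ t, w t • vecMulVec (Y t) (X t)).det =
      ∑ p : n → ι, (∏ i, w (p i)) * ((of (X ∘ p)).det * (of (Y ∘ p)).det) := by
  classical
  have expand : (∑ t, w t • vecMulVec (Y t) (X t)).det =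
      ∑ p : n → ι, (∏ i, w (p i) * Y (p i) i) * (of (X ∘ p)).det := by
    have hrows : (∑ t, w t • vecMulVec (Y t) (X t)) =
        fun i => ∑ t, (w t * Y t i) • X t := by
      ext i j
      simp [Matrix.sum_apply, vecMulVec_apply, mul_assoc]
    have key := (detRowAlternating (R := ℝ) (n := n)).toMultilinearMap.map_sum
      (fun i t => (w t * Y t i) • X t)
    rw [hrows]
    refine key.trans (Finset.sum_congr rfl fun p _ => ?_)
    exact (detRowAlternating (R := ℝ) (n := n)).toMultilinearMap.map_smul_univ
      (fun i => w (p i) * Y (p i) i) (fun i => X (p i))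
  have reindex : ∀ σ : Equiv.Perm n, (∑ t, w t • vecMulVec (Y t) (X t)).det =
      ∑ p : n → ι, (∏ i, w (p i)) * (of (X ∘ p)).det *
        ((Equiv.Perm.sign σ : ℤ) * ∏ i, (of (Y ∘ p)) (σ i) i) := by
    intro σ
    rw [expand, ← (Equiv.arrowCongr σ (Equiv.refl ι)).symm.sum_comp]
    refine Finset.sum_congr rfl fun p _ => ?_
    have h1 : (of (X ∘ (p ∘ σ))).det = (Equiv.Perm.sign σ : ℤ) * (of (X ∘ p)).det := by
      rw [← det_permute]; rfl
    have h2 : ∏ i, w (p (σ i)) = ∏ i, w (p i) := Equiv.prod_comp σ (fun i => w (p i))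
    have h3 : (Equiv.arrowCongr σ (Equiv.refl ι)).symm p = p ∘ σ := by
      ext; simp [Equiv.arrowCongr]
    rw [h3, h1, Finset.prod_mul_distrib]
    simp only [Function.comp_apply, h2, of_apply]
    ring
  calc ((Fintype.card n).factorial : ℝ) * (∑ t, w t • vecMulVec (Y t) (X t)).det
      = ∑ _σ : Equiv.Perm n, (∑ t, w t • vecMulVec (Y t) (X t)).det := by
        simp [Fintype.card_perm]
    _ = ∑ σ : Equiv.Perm n, ∑ p : n → ι, (∏ i, w (p i)) * (of (X ∘ p)).det *
        ((Equiv.Perm.sign σ : ℤ) * ∏ i, (of (Y ∘ p)) (σ i) i) :=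
        Finset.sum_congr rfl fun σ _ => reindex σ
    _ = _ := by
        rw [Finset.sum_comm]
        refine Finset.sum_congr rfl fun p _ => ?_
        rw [← Finset.mul_sum, ← det_apply', mul_assoc]

/-- Sign of a nonnegatively weighted sum of rank-one matrices, from the signs of the minors. -/
theorem det_sum_vecMulVec_pos {ι n : Type*} [Fintype ι] [Fintype n] [DecidableEq n]
    {w : ι → ℝ} {X Y : ι → n → ℝ} {ε : ℝ} (hw : ∀ t, 0 ≤ w t)
    (hXY : ∀ p : n → ι, Function.Injective p → 0 < ε * ((of (X ∘ p)).det * (of (Y ∘ p)).det))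
    (hsupp : ∃ p : n → ι, Function.Injective p ∧ ∀ i, 0 < w (p i)) :
    0 < ε * (∑ t, w t • vecMulVec (Y t) (X t)).det := by
  have h := factorial_mul_det_sum_vecMulVec w X Y
  have hpos : 0 < ∑ p : n → ι, (∏ i, w (p i)) * (ε * ((of (X ∘ p)).det * (of (Y ∘ p)).det)) := by
    obtain ⟨p, hp, hwp⟩ := hsupp
    refine Finset.sum_pos' (fun q _ => ?_)
      ⟨p, Finset.mem_univ _, mul_pos (Finset.prod_pos fun i _ => hwp i) (hXY p hp)⟩
    by_cases hq : Function.Injective q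
    · exact mul_nonneg (Finset.prod_nonneg fun i _ => hw _) (hXY q hq).le
    · obtain ⟨i, j, hij, hne⟩ : ∃ i j, q i = q j ∧ i ≠ j := by
        simpa [Function.Injective] using hq
      have : (of (X ∘ q)).det = 0 := det_zero_of_row_eq hne (congrArg X hij)
      simp [this]
  have hf : (0 : ℝ) < (Fintype.card n).factorial := by positivity
  refine pos_of_mul_pos_right (b := _) (a := ((Fintype.card n).factorial : ℝ)) ?_ hf.le
  calc 0 < _ := hpos
    _ = ε * ∑ p : n → ι, (∏ i, w (p i)) * ((of (X ∘ p)).det * (of (Y ∘ p)).det) := by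
        rw [Finset.mul_sum]
        exact Finset.sum_congr rfl fun p _ => by ring
    _ = _ := by rw [← h]; ring

/-- A sign pattern compatible with a functional on the family `Z` is not a linear dependency of a
family `X` whose maximal minors have products of constant sign with those of `Z`. -/
theorem sum_smul_ne_zero_of_sign {ι n : Type*} [Fintype ι] [Fintype n] [DecidableEq n]
    {X Z : ι → n → ℝ} {ε : ℝ} (hcard : Fintype.card n ≤ Fintype.card ι)
    (hXZ : ∀ p : n → ι, Function.Injective p → 0 < ε * ((of (X ∘ p)).det * (of (Z ∘ p)).det))
    {x : n → ℝ} {v : ι → ℝ} (hv : v ≠ 0) (hsign : ∀ t, v t ≠ 0 → 0 < v t * (x ⬝ᵥ Z t)) :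
    ∑ t, v t • X t ≠ 0 := by
  classical
  intro h0
  set S : Finset ι := Finset.univ.filter fun t => v t ≠ 0 with hS
  rcases le_or_gt (Fintype.card n) S.card with hle | hlt
  · let w : ι → ℝ := fun t => v t / (x ⬝ᵥ Z t)
    have hwpos : ∀ t, v t ≠ 0 → 0 < w t := fun t ht => by
      have h1 := hsign t ht
      have hne : x ⬝ᵥ Z t ≠ 0 := fun h => by simp [h] at h1
      have : w t = v t * (x ⬝ᵥ Z t) / (x ⬝ᵥ Z t) ^ 2 := by simp only [w]; field_simp
      rw [this]; positivity
    have hw0 : ∀ t, v t = 0 → w t = 0 := fun t ht => by simp [w, ht]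
    have hx : x ≠ 0 := by
      rintro rfl
      obtain ⟨t, ht⟩ := Function.ne_iff.1 hv
      simpa using hsign t ht
    have hdet := det_sum_vecMulVec_pos (w := w) (X := X) (Y := Z) (ε := ε)
      (fun t => by
        by_cases ht : v t = 0
        · exact (hw0 t ht).ge
        · exact (hwpos t ht).le) hXZ (by
        obtain ⟨e⟩ : Nonempty (n ↪ S) :=
          Function.Embedding.nonempty_of_card_le (by simpa using hle)
        exact ⟨fun i => e i, fun i j hij => e.injective (Subtype.ext hij),
          fun i => hwpos _ (Finset.mem_filter.1 (e i).2).2⟩)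
    have hker : x ᵥ* (∑ t, w t • vecMulVec (Z t) (X t)) = 0 := by
      rw [← h0, vecMul_sum]
      refine Finset.sum_congr rfl fun t _ => ?_
      rw [vecMul_smul, vecMul_vecMulVec, smul_smul]
      by_cases ht : v t = 0
      · simp [ht, hw0 t ht]
      · have hne : x ⬝ᵥ Z t ≠ 0 := fun h => by simpa [h] using hsign t ht
        congr 1
        simp only [w]; field_simp
    have := exists_vecMul_eq_zero_iff.1 ⟨x, hx, hker⟩
    simp [this] at hdet
  · obtain ⟨U, hSU, hU⟩ := Finset.exists_superset_card_eq hlt.le hcard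
    obtain ⟨e⟩ : Nonempty (n ≃ U) := Fintype.card_eq.1 (by simpa using hU.symm)
    have hdet : (of (X ∘ fun i => (e i : ι))).det ≠ 0 := fun h => by
      simpa [h] using hXZ (fun i => e i) fun i j hij => e.injective (Subtype.ext hij)
    have hker : (fun i => v (e i)) ᵥ* of (X ∘ fun i => (e i : ι)) = 0 := by
      ext j
      have := congrFun h0 j
      simp only [Finset.sum_apply, Pi.smul_apply, smul_eq_mul, Pi.zero_apply] at this
      rw [← Finset.sum_subset (Finset.subset_univ U)] at this
      · rw [← Finset.sum_coe_sort, ← e.sum_comp] at this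
        simpa [vecMul, dotProduct] using this
      · intro t _ ht
        have : v t = 0 := by
          by_contra h
          exact ht (hSU (by simp [hS, h]))
        simp [this]
    have hz : (fun i => v (e i)) = 0 := by
      by_contra hne
      exact hdet (exists_vecMul_eq_zero_iff.1 ⟨_, hne, hker⟩)
    refine hv (funext fun t => ?_)
    by_contra ht
    have htU : t ∈ U := hSU (by simpa [hS] using ht)
    apply ht
    simpa using congrFun hz (e.symm ⟨t, htU⟩)

end CauchyBinet

section Transversal
open Matrix Filter Topology

/-- Two finite families with opposite maximal minors admit a nonzero functional that is nowhere
of the same strict sign on both. -/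
theorem exists_forall_dotProduct_mul_nonpos {ι n : Type*} [Fintype ι] [Fintype n] [Nonempty n]
    [DecidableEq n] {X Y : ι → n → ℝ} (hcard : Fintype.card n ≤ Fintype.card ι)
    (hXY : ∀ p : n → ι, Function.Injective p → (of (X ∘ p)).det * (of (Y ∘ p)).det < 0) :
    ∃ x : n → ℝ, x ≠ 0 ∧ ∀ t, (x ⬝ᵥ X t) * (x ⬝ᵥ Y t) ≤ 0 := by
  by_contra! hcon
  have hXX : ∀ p : n → ι, Function.Injective p →
      0 < (1 : ℝ) * ((of (X ∘ p)).det * (of (X ∘ p)).det) := fun p hp => by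
    have : (of (X ∘ p)).det ≠ 0 := fun h => by simpa [h] using hXY p hp
    rw [one_mul]
    exact mul_self_pos.2 this
  have hXY' : ∀ p : n → ι, Function.Injective p →
      0 < (-1 : ℝ) * ((of (X ∘ p)).det * (of (Y ∘ p)).det) := fun p hp => by
    linarith [hXY p hp]
  obtain ⟨e⟩ : Nonempty (n ↪ ι) := Function.Embedding.nonempty_of_card_le hcard
  have hA := det_sum_vecMulVec_pos (w := fun _ => (1 : ℝ)) (fun _ => zero_le_one) hXX
    ⟨e, e.injective, fun _ => one_pos⟩
  have hB := det_sum_vecMulVec_pos (w := fun _ => (1 : ℝ)) (fun _ => zero_le_one) hXY'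
    ⟨e, e.injective, fun _ => one_pos⟩
  let L : (ι → n → ℝ) → (n → ℝ) →L[ℝ] (n → ℝ) := fun Z =>
    LinearMap.toContinuousLinearMap (toLin' (∑ t, (1 : ℝ) • vecMulVec (Z t) (X t))ᵀ)
  have hLdet : ∀ Z, (L Z).det = (∑ t, (1 : ℝ) • vecMulVec (Z t) (X t)).det := fun Z => by
    simp only [L, ContinuousLinearMap.det, LinearMap.coe_toContinuousLinearMap,
      LinearMap.det_toLin', det_transpose]
  have hLapply : ∀ Z x, L Z x = ∑ t, (x ⬝ᵥ Z t) • X t := fun Z x => by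
    change (∑ t, (1 : ℝ) • vecMulVec (Z t) (X t))ᵀ *ᵥ x = _
    rw [mulVec_transpose, vecMul_sum]
    simp [vecMul_vecMulVec]
  let ψ := Real.smoothTransition
  let q : (n → ℝ) → ℝ := fun x => ∑ i, x i ^ 2
  let pos : ℝ → ℝ := expNegInvGlue
  -- `s t x` has the common sign of the two functionals at `t`, and vanishes if there is none.
  let s : ι → (n → ℝ) → ℝ := fun t x =>
    pos (x ⬝ᵥ X t) * pos (x ⬝ᵥ Y t) - pos (-(x ⬝ᵥ X t)) * pos (-(x ⬝ᵥ Y t))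
  let α : (n → ℝ) → ℝ := fun x => ψ (q x - 2)
  let β : (n → ℝ) → ℝ := fun x => ψ (2 - q x)
  let c : ι → (n → ℝ) → ℝ := fun t x =>
    α x * (x ⬝ᵥ X t) + β x * (x ⬝ᵥ Y t) + (1 - α x - β x) * s t x
  let G : (n → ℝ) → n → ℝ := fun x => ∑ t, c t x • X t
  have hqcont : ContDiff ℝ 1 q := ContDiff.sum fun i _ => (contDiff_apply ℝ ℝ i).pow 2
  have hdot : ∀ z : n → ℝ, ContDiff ℝ 1 fun x : n → ℝ => x ⬝ᵥ z := fun z =>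
    ContDiff.sum fun i _ => (contDiff_apply ℝ ℝ i).mul contDiff_const
  have hpos : ContDiff ℝ 1 pos := expNegInvGlue.contDiff (n := 1)
  have hψ : ContDiff ℝ 1 ψ := Real.smoothTransition.contDiff (n := 1)
  have hα : ContDiff ℝ 1 α := hψ.comp (hqcont.sub contDiff_const)
  have hβ : ContDiff ℝ 1 β := hψ.comp (contDiff_const.sub hqcont)
  have hs : ∀ t, ContDiff ℝ 1 (s t) := fun t =>
    ((hpos.comp (hdot _)).mul (hpos.comp (hdot _))).sub
      ((hpos.comp (hdot _).neg).mul (hpos.comp (hdot _).neg))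
  have hG : ContDiff ℝ 1 G := ContDiff.sum fun t _ =>
    (((hα.mul (hdot _)).add (hβ.mul (hdot _))).add
      (((contDiff_const.sub hα).sub hβ).mul (hs t))).smul contDiff_const
  have hsign : ∀ t x, 0 ≤ s t x * (x ⬝ᵥ X t) ∧ 0 ≤ s t x * (x ⬝ᵥ Y t) ∧
      (0 < (x ⬝ᵥ X t) * (x ⬝ᵥ Y t) → s t x ≠ 0) ∧
      (s t x ≠ 0 → 0 < (x ⬝ᵥ X t) * (x ⬝ᵥ Y t)) := by
    intro t x
    simp only [s, pos]
    generalize x ⬝ᵥ X t = a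
    generalize x ⬝ᵥ Y t = b
    have h0 : ∀ {u : ℝ}, u ≤ 0 → expNegInvGlue u = 0 := expNegInvGlue.zero_of_nonpos
    have h1 : ∀ {u : ℝ}, 0 < u → 0 < expNegInvGlue u := expNegInvGlue.pos_of_pos
    rcases lt_trichotomy a 0 with ha | ha | ha
    · rcases lt_or_ge b 0 with hb | hb
      · have h := mul_pos (h1 (neg_pos.2 ha)) (h1 (neg_pos.2 hb))
        rw [h0 ha.le, zero_mul, zero_sub]
        exact ⟨by nlinarith, by nlinarith, fun _ => (neg_neg_of_pos h).ne,
          fun _ => mul_pos_of_neg_of_neg ha hb⟩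
      · have : a * b ≤ 0 := mul_nonpos_of_nonpos_of_nonneg ha.le hb
        rw [h0 ha.le, h0 (neg_nonpos.2 hb)]
        simp [this]
    · simp [ha, h0 le_rfl]
    · rcases lt_or_ge 0 b with hb | hb
      · have h := mul_pos (h1 ha) (h1 hb)
        rw [h0 (neg_nonpos.2 ha.le), zero_mul, sub_zero]
        exact ⟨by positivity, by positivity, fun _ => h.ne', fun _ => mul_pos ha hb⟩
      · have : a * b ≤ 0 := mul_nonpos_of_nonneg_of_nonpos ha.le hb
        rw [h0 (neg_nonpos.2 ha.le), h0 hb]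
        simp [this]
  have blend : ∀ {l u v : ℝ}, 0 ≤ l → l ≤ 1 → 0 ≤ u * v → (u ≠ 0 → v ≠ 0) →
      l * v + (1 - l) * u ≠ 0 → 0 < (l * v + (1 - l) * u) * v := by
    intro l u v hl hl1 huv hne hw
    have hv : v ≠ 0 := fun hv => by
      have hu : u = 0 := by
        by_contra hu
        exact hne hu hv
      simp [hu, hv] at hw
    refine lt_of_le_of_ne ?_ (mul_ne_zero hw hv).symm
    nlinarith [mul_nonneg hl (sq_nonneg v), mul_nonneg (sub_nonneg.2 hl1) huv]
  have blend_ne : ∀ {l u v : ℝ}, 0 ≤ l → l ≤ 1 → 0 < u * v → l * v + (1 - l) * u ≠ 0 := by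
    intro l u v hl hl1 huv hw
    have hv : 0 < v ^ 2 := by
      have : v ≠ 0 := right_ne_zero_of_mul huv.ne'
      positivity
    have hsum : l * v ^ 2 + (1 - l) * (u * v) = 0 := by linear_combination v * hw
    rcases hl.eq_or_lt with h | h
    · rw [← h] at hsum
      linarith
    · nlinarith [mul_pos h hv, mul_nonneg (sub_nonneg.2 hl1) huv.le]
  have hG0 : ∀ x, x ≠ 0 → G x ≠ 0 := by
    intro x hx
    obtain ⟨t₀, ht₀⟩ := hcon x hx
    have hs₀ := (hsign t₀ x).2.2.1 ht₀
    rcases le_total (q x) 2 with hq | hq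
    · have hα0 : α x = 0 := Real.smoothTransition.zero_of_nonpos (by linarith)
      have hc : ∀ t, c t x = β x * (x ⬝ᵥ Y t) + (1 - β x) * s t x := fun t => by
        simp only [c, hα0]; ring
      have hβ0 : 0 ≤ β x := Real.smoothTransition.nonneg _
      have hβ1 : β x ≤ 1 := Real.smoothTransition.le_one _
      refine sum_smul_ne_zero_of_sign hcard hXY' (x := x) (v := fun t => c t x)
        (Function.ne_iff.2 ⟨t₀, ?_⟩) fun t ht => ?_
      · rw [hc]
        exact blend_ne hβ0 hβ1 ((hsign t₀ x).2.1.lt_of_ne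
          (mul_ne_zero hs₀ (right_ne_zero_of_mul ht₀.ne')).symm)
      · simp only [hc] at ht ⊢
        exact blend hβ0 hβ1 (hsign t x).2.1
          (fun h => right_ne_zero_of_mul ((hsign t x).2.2.2 h).ne') ht
    · have hβ0 : β x = 0 := Real.smoothTransition.zero_of_nonpos (by linarith)
      have hc : ∀ t, c t x = α x * (x ⬝ᵥ X t) + (1 - α x) * s t x := fun t => by
        simp only [c, hβ0]; ring
      have hα0 : 0 ≤ α x := Real.smoothTransition.nonneg _
      have hα1 : α x ≤ 1 := Real.smoothTransition.le_one _
      refine sum_smul_ne_zero_of_sign hcard hXX (x := x) (v := fun t => c t x)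
        (Function.ne_iff.2 ⟨t₀, ?_⟩) fun t ht => ?_
      · rw [hc]
        exact blend_ne hα0 hα1 ((hsign t₀ x).1.lt_of_ne
          (mul_ne_zero hs₀ (left_ne_zero_of_mul ht₀.ne')).symm)
      · simp only [hc] at ht ⊢
        exact blend hα0 hα1 (hsign t x).1
          (fun h => left_ne_zero_of_mul ((hsign t x).2.2.2 h).ne') ht
  refine not_det_neg_of_forall_ne_zero (A := L X) (B := L Y) hG hG0 ?_ ?_ ?_ ?_
  · have : ∀ᶠ x in cocompact (n → ℝ), 2 ≤ ‖x‖ :=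
      (tendsto_norm_cocompact_atTop (E := n → ℝ)).eventually_ge_atTop 2
    filter_upwards [this] with x hx
    have hq : 3 ≤ q x := by
      have h1 : ‖x‖ ≤ √(q x) := (pi_norm_le_iff_of_nonneg (Real.sqrt_nonneg _)).2 fun i =>
        Real.abs_le_sqrt (Finset.single_le_sum (f := fun i => x i ^ 2)
          (fun j _ => sq_nonneg _) (Finset.mem_univ i))
      have h2 : 2 ≤ √(q x) := hx.trans h1
      have h3 := (Real.le_sqrt' two_pos).1 h2
      linarith
    have hα1 : α x = 1 := Real.smoothTransition.one_of_one_le (by linarith)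
    have hβ0 : β x = 0 := Real.smoothTransition.zero_of_nonpos (by linarith)
    simp [hLapply, G, c, hα1, hβ0]
  · have : ∀ᶠ x in 𝓝 (0 : n → ℝ), q x < 1 :=
      (hqcont.continuous.tendsto 0).eventually (gt_mem_nhds (by simp [q]))
    filter_upwards [this] with x hx
    have hα0 : α x = 0 := Real.smoothTransition.zero_of_nonpos (by linarith)
    have hβ1 : β x = 1 := Real.smoothTransition.one_of_one_le (by linarith)
    simp [hLapply, G, c, hα0, hβ1]
  · rw [hLdet]
    linarith
  · rw [hLdet]
    linarith

end Transversal

section Curves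
open Matrix

/-- The homogeneous coordinates of a point, with last coordinate `1`. -/
def affineLift {d : ℕ} (x : Fin d → ℝ) : Fin (d + 1) → ℝ :=
  fun j => Fin.lastCases (1 : ℝ) (fun j' => x j') j

theorem det_affineLift {d : ℕ} (a : Fin (d + 1) → (Fin d → ℝ)) :
    (of fun i => affineLift (a i)).det = liftDet a := by
  rw [liftDet, ← det_transpose]
  rfl

theorem dotProduct_affineLift {d : ℕ} (y : Fin (d + 1) → ℝ) (x : Fin d → ℝ) :
    y ⬝ᵥ affineLift x = ∑ j : Fin d, y j.castSucc * x j + y (Fin.last d) := by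
  simp [dotProduct, Fin.sum_univ_castSucc, affineLift]

/-- The product of two determinants is unchanged by a simultaneous sorting of the rows. -/
theorem exists_strictMono_det_mul_det_eq {m : ℕ} {α : Type*} [LinearOrder α] {p : Fin m → α}
    (hp : Function.Injective p) (X Y : α → Fin m → ℝ) :
    ∃ σ : Equiv.Perm (Fin m), StrictMono (p ∘ σ) ∧
      (of (X ∘ p)).det * (of (Y ∘ p)).det =
        (of (X ∘ (p ∘ σ))).det * (of (Y ∘ (p ∘ σ))).det := by
  refine ⟨Tuple.sort p, (Tuple.monotone_sort p).strictMono_of_injective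
    (hp.comp (Tuple.sort p).injective), ?_⟩
  have h : ∀ Z : α → Fin m → ℝ, (of (Z ∘ (p ∘ Tuple.sort p))).det =
      (Equiv.Perm.sign (Tuple.sort p) : ℤ) * (of (Z ∘ p)).det := fun Z => by
    rw [← det_permute]; rfl
  rw [h X, h Y]
  rcases Int.units_eq_one_or (Equiv.Perm.sign (Tuple.sort p)) with h | h <;> simp [h]

end Curves

/-- **Cutting closed convex curves.** If d is even and `C₁`, `C₂` are closed convex curves
in ℝ^d with opposite orientations, then there is an affine hyperplane such that for every
t ∈ [0,1] the points `C₁ t` and `C₂ t` are never both in the same open halfspace. -/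
theorem cutting_closed_convex_curves {d : ℕ} (hd : Even d) (C₁ C₂ : ℝ → (Fin d → ℝ))
    (h₁ : IsClosedConvexCurve C₁) (h₂ : IsClosedConvexCurve C₂)
    (hopp : (PosOrientedClosed C₁ ∧ NegOrientedClosed C₂) ∨
            (NegOrientedClosed C₁ ∧ PosOrientedClosed C₂)) :
    ∃ (u : Fin d → ℝ) (c : ℝ), u ≠ 0 ∧
      ∀ t ∈ Icc (0 : ℝ) 1,
        ¬((∑ j, u j * C₁ t j) < c ∧ (∑ j, u j * C₂ t j) < c) ∧
        ¬(c < (∑ j, u j * C₁ t j) ∧ c < (∑ j, u j * C₂ t j)) := by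
  classical
  let X : ℝ → Fin (d + 1) → ℝ := fun t => affineLift (C₁ t)
  let Y : ℝ → Fin (d + 1) → ℝ := fun t => affineLift (C₂ t)
  have hneg : ∀ p : Fin (d + 1) → ℝ, Function.Injective p → (∀ i, p i ∈ Ico (0 : ℝ) 1) →
      (Matrix.of (X ∘ p)).det * (Matrix.of (Y ∘ p)).det < 0 := by
    intro p hp hmem
    obtain ⟨σ, hσ, heq⟩ := exists_strictMono_det_mul_det_eq hp X Y
    have hX : (Matrix.of (X ∘ (p ∘ σ))).det = liftDet fun i => C₁ ((p ∘ σ) i) :=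
      det_affineLift _
    have hY : (Matrix.of (Y ∘ (p ∘ σ))).det = liftDet fun i => C₂ ((p ∘ σ) i) :=
      det_affineLift _
    rw [heq, hX, hY]
    rcases hopp with ⟨hP, hN⟩ | ⟨hN, hP⟩
    · exact mul_neg_of_pos_of_neg (hP _ hσ fun i => hmem _) (hN _ hσ fun i => hmem _)
    · exact mul_neg_of_neg_of_pos (hN _ hσ fun i => hmem _) (hP _ hσ fun i => hmem _)
  obtain ⟨F₀, hF₀, hF₀card⟩ :=
    (Set.Ico_infinite (zero_lt_one (α := ℝ))).exists_subset_card_eq (d + 1)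
  let K : Ico (0 : ℝ) 1 → Set (Fin (d + 1) → ℝ) := fun t => {x | (x ⬝ᵥ X t) * (x ⬝ᵥ Y t) ≤ 0}
  have hKclosed : ∀ t, IsClosed (K t) := fun t =>
    isClosed_le (by unfold dotProduct; fun_prop) continuous_const
  have hfin : ∀ F : Finset (Ico (0 : ℝ) 1),
      (Metric.sphere (0 : Fin (d + 1) → ℝ) 1 ∩ ⋂ t ∈ F, K t).Nonempty := by
    intro F
    let U : Finset ℝ := F.image Subtype.val ∪ F₀
    have hU : ∀ t ∈ U, t ∈ Ico (0 : ℝ) 1 := fun t ht => by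
      rcases Finset.mem_union.1 ht with h | h
      · obtain ⟨s, -, rfl⟩ := Finset.mem_image.1 h
        exact s.2
      · exact hF₀ h
    obtain ⟨x, hx, hxU⟩ := exists_forall_dotProduct_mul_nonpos (n := Fin (d + 1))
      (X := fun t : U => X t) (Y := fun t : U => Y t)
      (by simpa [hF₀card] using Finset.card_le_card (Finset.subset_union_right :
        F₀ ⊆ F.image Subtype.val ∪ F₀))
      (fun p hp => hneg (fun i => p i) (Subtype.val_injective.comp hp) fun i => hU _ (p i).2)
    have hxn : ‖x‖ ≠ 0 := norm_ne_zero_iff.2 hx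
    refine ⟨‖x‖⁻¹ • x, by simp [norm_smul, hxn], mem_iInter₂.2 fun t ht => ?_⟩
    have := hxU ⟨t, Finset.mem_union_left _ (Finset.mem_image_of_mem _ ht)⟩
    simp only [K, mem_ofPred_eq, smul_dotProduct, smul_eq_mul]
    calc _ = ‖x‖⁻¹ ^ 2 * ((x ⬝ᵥ X t) * (x ⬝ᵥ Y t)) := by ring
      _ ≤ 0 := mul_nonpos_of_nonneg_of_nonpos (sq_nonneg _) this
  obtain ⟨x, hx1, hxK⟩ := (isCompact_sphere (0 : Fin (d + 1) → ℝ) 1).inter_iInter_nonempty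
    K hKclosed hfin
  have hx : x ≠ 0 := by
    rintro rfl
    simp at hx1
  have hval : ∀ t ∈ Ico (0 : ℝ) 1,
      (∑ j : Fin d, x j.castSucc * C₁ t j + x (Fin.last d)) *
        (∑ j : Fin d, x j.castSucc * C₂ t j + x (Fin.last d)) ≤ 0 := fun t ht => by
    simpa only [K, X, Y, mem_ofPred_eq, dotProduct_affineLift] using mem_iInter.1 hxK ⟨t, ht⟩
  refine ⟨fun j => x j.castSucc, -x (Fin.last d), fun hu => hx ?_, fun t ht => ?_⟩
  · have hu' : ∀ j : Fin d, x j.castSucc = 0 := fun j => congrFun hu j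
    have hlast : x (Fin.last d) = 0 := by
      have := hval 0 ⟨le_rfl, one_pos⟩
      simp only [hu', zero_mul, Finset.sum_const_zero, zero_add] at this
      nlinarith [mul_self_nonneg (x (Fin.last d)), mul_self_eq_zero (a := x (Fin.last d))]
    exact funext fun j => Fin.lastCases hlast hu' j
  · have hprod : (∑ j : Fin d, x j.castSucc * C₁ t j + x (Fin.last d)) *
        (∑ j : Fin d, x j.castSucc * C₂ t j + x (Fin.last d)) ≤ 0 := by
      rcases ht.2.eq_or_lt with rfl | hlt
      · rw [← h₁.2.1, ← h₂.2.1]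
        exact hval 0 ⟨le_rfl, one_pos⟩
      · exact hval t ⟨ht.1, hlt⟩
    constructor <;> rintro ⟨ha, hb⟩
    · exact hprod.not_gt (mul_pos_of_neg_of_neg (by linarith) (by linarith))
    · exact hprod.not_gt (mul_pos (by linarith) (by linarith))
end

section
/- Let $A$ and $B$ be finite point sets in $\mathbb{R}^d$, each affinely spanning $\mathbb{R}^d$, and let $\gamma \colon A \to B$ be an order-type reversing bijection. Then there exists an affine hyperplane $H \subset \mathbb{R}^d$ which intersects every closed segment $[a, \gamma(a)]$ with $a \in A$. -/
open Set

open MeasureTheory Polynomial in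
/-- If the integral of a family of polynomials of bounded degree is constant on an infinite set of
evaluation points, then it is constant everywhere. -/
theorem integral_polynomial_eval_eq_of_infinite {α : Type*} [MeasurableSpace α] {μ : Measure α}
    {P : α → ℝ[X]} {N : ℕ} (hN : ∀ x, (P x).natDegree ≤ N)
    (hint : ∀ t, Integrable (fun x => (P x).eval t) μ) {T : Set ℝ} (hT : T.Infinite) {c : ℝ}
    (hc : ∀ t ∈ T, ∫ x, (P x).eval t ∂μ = c) (t : ℝ) : ∫ x, (P x).eval t ∂μ = c := by
  obtain ⟨s, hsT, hs⟩ := hT.exists_subset_card_eq (N + 1)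
  have hinj : Set.InjOn (id : ℝ → ℝ) s := Function.injective_id.injOn
  have key : ∀ x, (P x).eval t = ∑ i ∈ s, (P x).eval i * (Lagrange.basis s id i).eval t := by
    intro x
    have h := Lagrange.eq_interpolate (f := P x) hinj <| by
      rw [hs]
      exact lt_of_le_of_lt degree_le_natDegree (by exact_mod_cast Nat.lt_succ_of_le (hN x))
    conv_lhs => rw [h]
    simp [Lagrange.interpolate_apply, eval_finsetSum]
  have hne : s.Nonempty := by rw [← Finset.card_pos, hs]; omega
  simp_rw [key]
  rw [integral_finsetSum _ fun i _ => (hint i).mul_const _]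
  simp_rw [integral_mul_const]
  rw [Finset.sum_congr rfl fun i hi => by rw [hc i (hsT hi)], ← Finset.mul_sum,
    ← eval_finsetSum, Lagrange.sum_basis hinj hne]
  simp

section Degree

open MeasureTheory Metric

variable {E : Type*} [NormedAddCommGroup E] [InnerProductSpace ℝ E] [FiniteDimensional ℝ E]

open Polynomial in
/-- Along the segment from the identity to a map `G` with displacement `v` and derivative
`1 + T` at `x`, the integrand of the change of variables formula is polynomial in the time `t`. -/
theorem exists_polynomial_eval_eq_pow_mul_det (x v : E) (T : E →L[ℝ] E) (C : ℝ) (k : ℕ) :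
    ∃ P : ℝ[X], P.natDegree ≤ 2 * k + Module.finrank ℝ E ∧ ∀ t,
      P.eval t = (1 - ‖x + t • v‖ ^ 2 / C) ^ k * (ContinuousLinearMap.id ℝ E + t • T).det := by
  let b := Module.finBasis ℝ E
  let A := LinearMap.toMatrix b b T.toLinearMap
  refine ⟨(1 - (Polynomial.C (‖x‖ ^ 2 / C) + Polynomial.C (2 * inner ℝ x v / C) * X
    + Polynomial.C (‖v‖ ^ 2 / C) * X ^ 2)) ^ k *
    ((X : ℝ[X]) • A.map Polynomial.C + (1 : Matrix _ _ ℝ).map Polynomial.C).det, ?_, fun t => ?_⟩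
  · refine natDegree_mul_le.trans (add_le_add ?_ ?_)
    · refine natDegree_pow_le.trans ?_
      rw [mul_comm]
      refine Nat.mul_le_mul_right _ ?_
      compute_degree
    · simpa using natDegree_det_X_add_C_le A 1
  · rw [eval_mul]
    congr 1
    · rw [norm_add_sq_real, inner_smul_right, norm_smul, mul_pow, Real.norm_eq_abs, sq_abs]
      simp only [eval_pow, eval_sub, eval_one, eval_add, eval_mul, eval_C, eval_X]
      ring
    · rw [← coe_evalRingHom, RingHom.map_det, ContinuousLinearMap.det, ← LinearMap.det_toMatrix b]
      congr 1
      have : ((ContinuousLinearMap.id ℝ E + t • T : E →L[ℝ] E) : E →ₗ[ℝ] E)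
          = LinearMap.id + t • (T : E →ₗ[ℝ] E) := rfl
      rw [this, (LinearMap.toMatrix b b).map_add, (LinearMap.toMatrix b b).map_smul,
        LinearMap.toMatrix_id]
      ext i j
      simp [Matrix.one_apply, A]
      split_ifs <;> simp [add_comm, mul_comm]

theorem det_id_add_pos_of_norm_lt_one {T : E →L[ℝ] E} (hT : ‖T‖ < 1) :
    0 < (ContinuousLinearMap.id ℝ E + T).det := by
  by_contra! hneg
  have hcont : ContinuousOn (fun s : ℝ => (ContinuousLinearMap.id ℝ E + s • T).det) (Icc 0 1) :=
    (ContinuousLinearMap.continuous_det.comp (by fun_prop)).continuousOn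
  obtain ⟨s, hs, h0⟩ := intermediate_value_Icc' zero_le_one hcont
    (show (0 : ℝ) ∈ Icc _ _ by
      constructor
      · simpa using hneg
      · simp [ContinuousLinearMap.det])
  have hker := LinearMap.bot_lt_ker_of_det_eq_zero h0
  obtain ⟨x, hx, hx0⟩ := (Submodule.ne_bot_iff _).1 hker.ne'
  have hx' : x + s • T x = 0 := hx
  have h1 : ‖x‖ = s * ‖T x‖ := by
    rw [← Real.norm_of_nonneg hs.1, ← norm_smul, ← norm_neg (s • T x),
      ← eq_neg_of_add_eq_zero_left hx']
  have h2 : s * ‖T x‖ ≤ 1 * (‖T‖ * ‖x‖) :=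
    mul_le_mul hs.2 (T.le_opNorm x) (norm_nonneg _) zero_le_one
  nlinarith [norm_pos_iff.2 hx0]

variable [MeasurableSpace E] [BorelSpace E]

/-- Change of variables for a `C¹` map equal to the identity near infinity, without injectivity:
both sides agree for small perturbations of the identity, and depend polynomially on time. -/
theorem setIntegral_pow_mul_det_eq {G : E → E} (hG : ContDiff ℝ 1 G) {R : ℝ}
    (hR : ∀ x, R ≤ ‖x‖ → G x = x) (C : ℝ) (k : ℕ) :
    ∫ x in closedBall (0 : E) R, (1 - ‖G x‖ ^ 2 / C) ^ k * (fderiv ℝ G x).det =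
      ∫ x in closedBall (0 : E) R, (1 - ‖x‖ ^ 2 / C) ^ k := by
  let g : E → E := fun x => G x - x
  have hgC : ContDiff ℝ 1 g := hG.sub contDiff_id
  have hsupp : HasCompactSupport g :=
    HasCompactSupport.of_support_subset_isCompact (isCompact_closedBall (0 : E) R) <| by
      intro x hx
      by_contra hxR
      have : R ≤ ‖x‖ := by simpa using (not_le.1 fun h => hxR (by simpa using h)).le
      exact hx (by simp [g, hR x this])
  obtain ⟨K, hK⟩ := hgC.lipschitzWith_of_hasCompactSupport hsupp one_ne_zero
  have hdiff : ∀ x, HasFDerivAt g (fderiv ℝ g x) x := fun x =>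
    (hgC.differentiable one_ne_zero x).hasFDerivAt
  choose P hPdeg hP using fun x =>
    exists_polynomial_eval_eq_pow_mul_det x (g x) (fderiv ℝ g x) C k
  have hcont : ∀ t, Continuous fun x => (P x).eval t := by
    intro t
    simp_rw [hP]
    have := hgC.continuous
    have := hgC.continuous_fderiv one_ne_zero
    exact (by fun_prop : Continuous fun x => (1 - ‖x + t • g x‖ ^ 2 / C) ^ k).mul
      (ContinuousLinearMap.continuous_det.comp (by fun_prop))
  have hmain := integral_polynomial_eval_eq_of_infinite
    (μ := volume.restrict (closedBall (0 : E) R)) hPdeg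
    (fun t => (hcont t).continuousOn.integrableOn_compact (isCompact_closedBall _ _))
    (T := Ioo 0 (1 / (K + 1) : ℝ)) (Ioo_infinite (by positivity))
    (c := ∫ x in closedBall (0 : E) R, (1 - ‖x‖ ^ 2 / C) ^ k) ?_ 1
  · rw [← hmain]
    refine integral_congr_ae (.of_forall fun x => ?_)
    have hfd : fderiv ℝ g x = fderiv ℝ G x - ContinuousLinearMap.id ℝ E :=
      ((hG.differentiable one_ne_zero x).hasFDerivAt.sub (hasFDerivAt_id x)).fderiv
    simp only [hP, hfd, one_smul, add_sub_cancel, g]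
  · rintro t ⟨ht0, ht1⟩
    have htK : t * K < 1 := by
      rw [lt_div_iff₀ (by positivity)] at ht1
      nlinarith [K.2]
    set F : E → E := fun x => x + t • g x with hF
    have hFd : ∀ x, HasFDerivAt F (ContinuousLinearMap.id ℝ E + t • fderiv ℝ g x) x := fun x =>
      (hasFDerivAt_id x).add ((hdiff x).const_smul t)
    have happ : ApproximatesLinearOn F (ContinuousLinearEquiv.refl ℝ E : E →L[ℝ] E) univ
        (t.toNNReal * K) := by
      rw [ApproximatesLinearOn.approximatesLinearOn_iff_lipschitzOnWith, lipschitzOnWith_univ]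
      refine LipschitzWith.of_dist_le_mul fun x y => ?_
      have := hK.dist_le_mul x y
      simp only [hF, Pi.sub_apply, ContinuousLinearEquiv.coe_coe, ContinuousLinearEquiv.refl_apply,
        add_sub_cancel_left, NNReal.coe_mul, Real.coe_toNNReal t ht0.le, dist_smul₀,
        Real.norm_of_nonneg ht0.le, mul_assoc]
      gcongr
    have hlt : Subsingleton E ∨ t.toNNReal * K <
        ‖((ContinuousLinearEquiv.refl ℝ E).symm : E →L[ℝ] E)‖₊⁻¹ := by
      rcases subsingleton_or_nontrivial E with h | h
      · exact .inl h
      · right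
        rw [← NNReal.coe_lt_coe]
        simpa [Real.coe_toNNReal t ht0.le] using htK
    have hinj : Function.Injective F := injOn_univ.1 (happ.injOn hlt)
    have hsurj : Function.Surjective F := happ.surjective hlt
    have hout : ∀ x, R ≤ ‖x‖ → F x = x := fun x hx => by simp [hF, g, hR x hx]
    have himg : F '' closedBall (0 : E) R = closedBall 0 R := by
      have hcompl : F '' (closedBall (0 : E) R)ᶜ = (closedBall 0 R)ᶜ := by
        have : EqOn F id (closedBall (0 : E) R)ᶜ := fun x hx => hout x (by
          simpa using (not_le.1 fun h => hx (by simpa using h)).le)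
        rw [this.image_eq, image_id]
      rwa [image_compl_eq ⟨hinj, hsurj⟩, compl_inj_iff] at hcompl
    have hcv := integral_image_eq_integral_abs_det_fderiv_smul volume
      (measurableSet_closedBall (x := (0 : E)) (ε := R))
      (fun x _ => (hFd x).hasFDerivWithinAt) hinj.injOn (fun y => (1 - ‖y‖ ^ 2 / C) ^ k)
    rw [himg] at hcv
    rw [hcv]
    refine integral_congr_ae (.of_forall fun x => ?_)
    have hnorm : ‖t • fderiv ℝ g x‖ < 1 := by
      rw [norm_smul, Real.norm_of_nonneg ht0.le]
      exact (mul_le_mul_of_nonneg_left (norm_fderiv_le_of_lipschitz ℝ hK) ht0.le).trans_lt htK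
    simp only [hP, abs_of_pos (det_id_add_pos_of_norm_lt_one hnorm), smul_eq_mul]
    rw [mul_comm]

/-- A `C¹` map of a finite-dimensional space that is the identity near infinity, linear near `0`
and has `0` as its only zero preserves the orientation at `0`. -/
theorem det_nonneg_of_eq_id_of_norm_ge {G : E → E} (hG : ContDiff ℝ 1 G) {R : ℝ}
    (hR : ∀ x, R ≤ ‖x‖ → G x = x) {L : E →L[ℝ] E} {r : ℝ} (hr : 0 < r)
    (hL : ∀ x, ‖x‖ ≤ r → G x = L x) (h0 : ∀ x, x ≠ 0 → G x ≠ 0) : 0 ≤ L.det := by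
  by_contra! hdet
  wlog hRpos : 0 < R generalizing R
  · exact this (R := 1) (fun x hx => hR x (by linarith)) one_pos
  set B := closedBall (0 : E) R
  have hB : IsCompact B := isCompact_closedBall _ _
  have hGc : Continuous G := hG.continuous
  have hDc : Continuous fun x => (fderiv ℝ G x).det :=
    ContinuousLinearMap.continuous_det.comp (hG.continuous_fderiv one_ne_zero)
  obtain ⟨C₁, hC₁⟩ := hB.exists_bound_of_continuousOn hGc.continuousOn
  obtain ⟨D₁, hD₁⟩ := hB.exists_bound_of_continuousOn hDc.continuousOn
  set C : ℝ := 1 + C₁ ^ 2 + R ^ 2 with hC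
  have hCpos : 0 < C := by positivity
  have hGC : ∀ x ∈ B, ‖G x‖ ^ 2 / C ≤ 1 := by
    intro x hx
    rw [div_le_one hCpos]
    nlinarith [hC₁ x hx, norm_nonneg (G x)]
  have hxC : ∀ x ∈ B, ‖x‖ ^ 2 / C ≤ 1 := by
    intro x hx
    rw [div_le_one hCpos]
    have : ‖x‖ ≤ R := by simpa [B] using hx
    nlinarith [norm_nonneg x]
  obtain ⟨δ₀, hδ₀, hδ₀'⟩ := (hB.diff (isOpen_ball (x := (0 : E)) (ε := r))).exists_forall_le'
    (f := fun x => ‖G x‖ ^ 2 / C) (a := 0) (by fun_prop) (by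
      rintro x ⟨-, hx⟩
      have hx0 : x ≠ 0 := by
        rintro rfl
        exact hx (mem_ball_self hr)
      have := norm_pos_iff.2 (h0 x hx0)
      positivity)
  set δ := min δ₀ 1
  have hδ : 0 < δ := lt_min hδ₀ one_pos
  have hδ1 : δ ≤ 1 := min_le_right _ _
  have hδle : ∀ x ∈ B \ ball 0 r, δ ≤ ‖G x‖ ^ 2 / C := fun x hx =>
    (min_le_left _ _).trans (hδ₀' x hx)
  set ρ := min R (Real.sqrt (δ / 2 * C)) with hρ
  have hρpos : 0 < ρ := lt_min hRpos (Real.sqrt_pos.2 (by positivity))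
  have hρB : closedBall (0 : E) ρ ⊆ B := closedBall_subset_closedBall (min_le_left _ _)
  have hρδ : ∀ x ∈ closedBall (0 : E) ρ, ‖x‖ ^ 2 / C ≤ δ / 2 := by
    intro x hx
    rw [div_le_iff₀ hCpos, ← Real.le_sqrt (norm_nonneg _) (by positivity)]
    have : ‖x‖ ≤ ρ := by simpa using hx
    exact this.trans (min_le_right _ _)
  have hDnn : 0 ≤ D₁ := (norm_nonneg _).trans (hD₁ 0 (mem_closedBall_self hRpos.le))
  set v := volume.real (closedBall (0 : E) ρ)
  set W := D₁ * volume.real (B \ ball (0 : E) r)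
  have hv : 0 < v := ENNReal.toReal_pos (measure_closedBall_pos volume _ hρpos).ne'
    (isCompact_closedBall _ _).measure_lt_top.ne
  have key : ∀ k : ℕ, (1 - δ / 2) ^ k * v ≤ (1 - δ) ^ k * W := by
    intro k
    have hint : Continuous fun x => (1 - ‖G x‖ ^ 2 / C) ^ k * (fderiv ℝ G x).det :=
      (by fun_prop : Continuous fun x => (1 - ‖G x‖ ^ 2 / C) ^ k).mul hDc
    have hint' : Continuous fun x : E => (1 - ‖x‖ ^ 2 / C) ^ k := by fun_prop
    have hI := setIntegral_pow_mul_det_eq hG hR C k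
    have h1 : (1 - δ / 2) ^ k * v ≤ ∫ x in B, (1 - ‖x‖ ^ 2 / C) ^ k := by
      calc (1 - δ / 2) ^ k * v = ∫ x in closedBall (0 : E) ρ, (1 - δ / 2) ^ k := by
            rw [setIntegral_const, smul_eq_mul, mul_comm]
        _ ≤ ∫ x in closedBall (0 : E) ρ, (1 - ‖x‖ ^ 2 / C) ^ k := by
            refine setIntegral_mono_on
              (continuous_const.continuousOn.integrableOn_compact (isCompact_closedBall _ _))
              (hint'.continuousOn.integrableOn_compact (isCompact_closedBall _ _))
              measurableSet_closedBall fun x hx => ?_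
            have := hρδ x hx
            exact pow_le_pow_left₀ (by linarith) (by linarith) _
        _ ≤ _ := by
            refine setIntegral_mono_set (hint'.continuousOn.integrableOn_compact hB) ?_
              (LE.le.eventuallyLE hρB)
            filter_upwards [ae_restrict_mem measurableSet_closedBall] with x hx
            exact pow_nonneg (by linarith [hxC x hx]) _
    have h2 : ∫ x in B ∩ ball 0 r, (1 - ‖G x‖ ^ 2 / C) ^ k * (fderiv ℝ G x).det ≤ 0 := by
      refine setIntegral_nonpos (measurableSet_closedBall.inter measurableSet_ball) ?_
      rintro x ⟨hxB, hx⟩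
      have hfd : fderiv ℝ G x = L := by
        have : G =ᶠ[nhds x] L := by
          filter_upwards [isOpen_ball.mem_nhds hx] with y hy
          exact hL y (by simpa using (mem_ball.1 hy).le)
        rw [this.fderiv_eq, L.fderiv]
      rw [hfd]
      exact mul_nonpos_of_nonneg_of_nonpos (pow_nonneg (by linarith [hGC x hxB]) _) hdet.le
    have h3 : ∫ x in B \ ball 0 r, (1 - ‖G x‖ ^ 2 / C) ^ k * (fderiv ℝ G x).det ≤
        (1 - δ) ^ k * W := by
      have hK := hB.diff (isOpen_ball (x := (0 : E)) (ε := r))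
      calc _ ≤ ∫ x in B \ ball (0 : E) r, (1 - δ) ^ k * D₁ := by
            refine setIntegral_mono_on (hint.continuousOn.integrableOn_compact hK)
              (continuous_const.continuousOn.integrableOn_compact hK) hK.measurableSet
              fun x hx => ?_
            have hnn : 0 ≤ 1 - ‖G x‖ ^ 2 / C := by linarith [hGC x hx.1]
            refine mul_le_mul_of_nonneg ?_ ?_ (pow_nonneg hnn _) hDnn
            · exact pow_le_pow_left₀ hnn (by linarith [hδle x hx]) _
            · exact (le_abs_self _).trans (hD₁ x hx.1)
        _ = _ := by
            rw [setIntegral_const, smul_eq_mul]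
            ring
    have h4 := integral_inter_add_sdiff (s := B) (t := ball (0 : E) r) (μ := volume)
      measurableSet_ball (hint.continuousOn.integrableOn_compact hB)
    linarith
  have hq : 0 < 1 - δ / 2 := by linarith
  have hlim : Filter.Tendsto (fun k : ℕ => ((1 - δ) / (1 - δ / 2)) ^ k * W) Filter.atTop
      (nhds (0 * W)) := by
    refine Filter.Tendsto.mul_const _ (tendsto_pow_atTop_nhds_zero_of_lt_one ?_ ?_)
    · exact div_nonneg (by linarith) hq.le
    · rw [div_lt_one hq]
      linarith
  rw [zero_mul] at hlim
  refine hv.not_ge (ge_of_tendsto' hlim fun k => ?_)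
  rw [div_pow, div_mul_eq_mul_div, le_div_iff₀ (pow_pos hq k), mul_comm]
  exact key k

end Degree

section OddMap

open Real

variable {ι E : Type*} [Fintype ι] [NormedAddCommGroup E] [InnerProductSpace ℝ E]

/-- The operator `∑ i, c i • a i ⊗ b i`. -/
noncomputable def rankOneSum (a b : ι → E) (c : ι → ℝ) : E →L[ℝ] E :=
  ∑ i, c i • (innerSL ℝ (b i)).smulRight (a i)

theorem rankOneSum_apply (a b : ι → E) (c : ι → ℝ) (x : E) :
    rankOneSum a b c x = ∑ i, (c i * inner ℝ (b i) x) • a i := by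
  simp [rankOneSum, mul_smul]

theorem inner_rankOneSum_apply (a b : ι → E) (c : ι → ℝ) (x : E) :
    inner ℝ (rankOneSum a b c x) x = ∑ i, c i * (inner ℝ (a i) x * inner ℝ (b i) x) := by
  rw [rankOneSum_apply, sum_inner]
  refine Finset.sum_congr rfl fun i _ => ?_
  rw [real_inner_smul_left]
  ring

variable [FiniteDimensional ℝ E]

/-- If all positive combinations of the rank-one operators `a i ⊗ b i` reverse the orientation,
then some nonzero vector is weakly separated in sign by every pair `a i`, `b i`. -/
theorem exists_ne_zero_forall_inner_mul_inner_nonpos (a b : ι → E)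
    (h : ∀ c : ι → ℝ, (∀ i, 0 < c i) → (rankOneSum a b c).det < 0) :
    ∃ w : E, w ≠ 0 ∧ ∀ i, inner ℝ (a i) w * inner ℝ (b i) w ≤ 0 := by
  by_contra! hpos
  borelize E
  let p : ι → E → ℝ := fun i x => inner ℝ (a i) x * inner ℝ (b i) x
  let m : ι → E → ℝ := fun i x => expNegInvGlue (p i x)
  let Q : E → ℝ := fun x => ∑ i, m i x * p i x
  let S : E → ℝ := fun x => ∑ i, p i x
  let s₁ : E → ℝ := fun x => smoothTransition (‖x‖ ^ 2 - 1)
  let s₂ : E → ℝ := fun x => smoothTransition (‖x‖ ^ 2 - 2)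
  let μ : ι → E → ℝ := fun i x => Q x / (1 + S x ^ 2) + m i x
  let c : E → ι → ℝ := fun x i => (1 - s₁ x) + s₁ x * μ i x
  let G : E → E := fun x => s₂ x • x + (1 - s₂ x) • rankOneSum a b (c x) x
  have hp : ∀ i, ContDiff ℝ 1 (p i) := fun i =>
    (contDiff_const.inner ℝ contDiff_id).mul (contDiff_const.inner ℝ contDiff_id)
  have hm : ∀ i, ContDiff ℝ 1 (m i) := fun i => expNegInvGlue.contDiff.comp (hp i)
  have hQ : ContDiff ℝ 1 Q := ContDiff.sum fun i _ => (hm i).mul (hp i)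
  have hS : ContDiff ℝ 1 S := ContDiff.sum fun i _ => hp i
  have hs₁ : ContDiff ℝ 1 s₁ :=
    smoothTransition.contDiff.comp ((contDiff_norm_sq ℝ).sub contDiff_const)
  have hs₂ : ContDiff ℝ 1 s₂ :=
    smoothTransition.contDiff.comp ((contDiff_norm_sq ℝ).sub contDiff_const)
  have hμ : ∀ i, ContDiff ℝ 1 (μ i) := fun i =>
    (hQ.div (contDiff_const.add (hS.pow 2)) fun x => by positivity).add (hm i)
  have hG : ContDiff ℝ 1 G := by
    simp only [G, c, rankOneSum_apply]
    exact (hs₂.smul contDiff_id).add ((contDiff_const.sub hs₂).smul (ContDiff.sum fun i _ =>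
      (((contDiff_const.sub hs₁).add (hs₁.mul (hμ i))).mul
        (contDiff_const.inner ℝ contDiff_id)).smul contDiff_const))
  have hmp : ∀ i x, 0 ≤ m i x * p i x := by
    intro i x
    rcases le_or_gt (p i x) 0 with hx | hx
    · simp [m, expNegInvGlue.zero_of_nonpos hx]
    · exact mul_nonneg (expNegInvGlue.nonneg _) hx.le
  have hQpos : ∀ x, x ≠ 0 → 0 < Q x := by
    intro x hx
    obtain ⟨i, hi⟩ := hpos x hx
    exact Finset.sum_pos' (fun i _ => hmp i x)
      ⟨i, Finset.mem_univ i, mul_pos (expNegInvGlue.pos_of_pos hi) hi⟩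
  have hμpos : ∀ x, x ≠ 0 → ∀ i, 0 < μ i x := fun x hx i =>
    add_pos_of_pos_of_nonneg (div_pos (hQpos x hx) (by positivity)) (expNegInvGlue.nonneg _)
  have hinj : ∀ c : ι → ℝ, (∀ i, 0 < c i) → ∀ x, x ≠ 0 → rankOneSum a b c x ≠ 0 := by
    intro c hc x hx h0
    refine hx ((LinearMap.equivOfDetNeZero _ (h c hc).ne).injective ?_)
    simpa using h0
  have hG0 : ∀ x, x ≠ 0 → G x ≠ 0 := by
    intro x hx h0
    rcases le_total (‖x‖ ^ 2) 2 with h2 | h2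
    · have hs₂x : s₂ x = 0 := smoothTransition.zero_of_nonpos (by linarith)
      refine hinj (c x) (fun i => ?_) x hx (by simpa [G, hs₂x] using h0)
      have h1 : s₁ x ≤ 1 := smoothTransition.le_one _
      have h1' : 0 ≤ s₁ x := smoothTransition.nonneg _
      have := hμpos x hx i
      change 0 < (1 - s₁ x) + s₁ x * μ i x
      rcases h1'.eq_or_lt with h' | h'
      · simp [← h']
      · nlinarith [mul_pos h' this]
    · have hs₁x : s₁ x = 1 := smoothTransition.one_of_one_le (by linarith)
      have hsum : 0 < ∑ i, μ i x * p i x := by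
        have : ∑ i, μ i x * p i x = Q x * ((1 + S x + S x ^ 2) / (1 + S x ^ 2)) := by
          have hne : 1 + S x ^ 2 ≠ 0 := by positivity
          simp only [μ, add_mul, Finset.sum_add_distrib, ← Finset.mul_sum]
          change Q x / (1 + S x ^ 2) * S x + Q x = _
          field_simp
          ring
        rw [this]
        exact mul_pos (hQpos x hx) (div_pos (by nlinarith [sq_nonneg (S x + 1)]) (by positivity))
      have hin : inner ℝ (G x) x = s₂ x * ‖x‖ ^ 2 + (1 - s₂ x) * ∑ i, μ i x * p i x := by
        simp only [G, c, inner_add_left, real_inner_smul_left, inner_rankOneSum_apply, hs₁x,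
          real_inner_self_eq_norm_sq]
        simp [p]
      rw [h0, inner_zero_left] at hin
      have h1 : s₂ x ≤ 1 := smoothTransition.le_one _
      have h1' : 0 ≤ s₂ x := smoothTransition.nonneg _
      rcases h1.eq_or_lt with h' | h'
      · rw [h'] at hin
        linarith
      · nlinarith [mul_pos (sub_pos.2 h') hsum]
  refine (h 1 fun _ => one_pos).not_ge
    (det_nonneg_of_eq_id_of_norm_ge hG (R := 2) (fun x hx => ?_) one_pos (fun x hx => ?_) hG0)
  · have : s₂ x = 1 := smoothTransition.one_of_one_le (by nlinarith)
    simp [G, this]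
  · have h1 : s₁ x = 0 := smoothTransition.zero_of_nonpos (by nlinarith [norm_nonneg x])
    have h2 : s₂ x = 0 := smoothTransition.zero_of_nonpos (by nlinarith [norm_nonneg x])
    have : c x = 1 := by ext i; simp [c, h1]
    simp [G, h2, this]

end OddMap

open Matrix in
/-- A form of the Cauchy–Binet formula, summing over all maps instead of all subsets. -/
theorem Matrix.factorial_card_mul_det_mul {m n R : Type*} [Fintype m] [Fintype n] [DecidableEq n]
    [CommRing R] (A : Matrix n m R) (B : Matrix m n R) :
    ((Fintype.card n).factorial : R) * (A * B).det =
      ∑ p : n → m, (A.submatrix id p).det * (B.submatrix p id).det := by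
  classical
  have hdet : (A * B).det = ∑ p : n → m, (∏ i, A i (p i)) * (B.submatrix p id).det := by
    have hrows : A * B = fun i => ∑ k, A i k • B k := by
      ext i j
      simp [Matrix.mul_apply, Finset.sum_apply]
    have h := (detRowAlternating (n := n) (R := R)).toMultilinearMap.map_sum
      (fun i k => A i k • B k)
    rw [← hrows] at h
    refine h.trans (Finset.sum_congr rfl fun p _ => ?_)
    exact (detRowAlternating (n := n) (R := R)).toMultilinearMap.map_smul_univ
      (fun i => A i (p i)) (fun i => B (p i))
  have hperm : ∀ σ : Equiv.Perm n, (A * B).det =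
      ∑ p : n → m, ((σ.sign : ℤ) : R) * (∏ i, A i (p (σ i))) * (B.submatrix p id).det := by
    intro σ
    rw [hdet, ← (Equiv.arrowCongr σ.symm (Equiv.refl m)).sum_comp]
    refine Finset.sum_congr rfl fun p _ => ?_
    have : (B.submatrix (p ∘ σ) id).det = ((σ.sign : ℤ) : R) * (B.submatrix p id).det :=
      Matrix.det_permute σ (B.submatrix p id)
    have he : Equiv.arrowCongr σ.symm (Equiv.refl m) p = p ∘ σ := by
      ext i
      simp
    rw [he, this]
    simp only [Function.comp]
    ring
  calc ((Fintype.card n).factorial : R) * (A * B).det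
      = ∑ _σ : Equiv.Perm n, (A * B).det := by
        simp [Fintype.card_perm]
    _ = _ := by
        rw [Finset.sum_congr rfl fun σ _ => hperm σ, Finset.sum_comm]
        refine Finset.sum_congr rfl fun p _ => ?_
        rw [← Finset.sum_mul, ← det_transpose (A.submatrix id p), det_apply' (A.submatrix id p)ᵀ]
        rfl

section Lift

variable {d : ℕ}

/-- The point `x` of `ℝ^d` with an additional last coordinate equal to `1`. -/
noncomputable def homogenize (x : Fin d → ℝ) : EuclideanSpace ℝ (Fin (d + 1)) :=
  WithLp.toLp 2 fun j => Fin.lastCases (1 : ℝ) (fun j' => x j') j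

theorem inner_homogenize (x : Fin d → ℝ) (w : EuclideanSpace ℝ (Fin (d + 1))) :
    inner ℝ (homogenize x) w = ∑ j, w (Fin.castSucc j) * x j + w (Fin.last d) := by
  simp [homogenize, PiLp.inner_apply, Fin.sum_univ_castSucc]

theorem AffineIndependent.liftDet_ne_zero {p : Fin (d + 1) → Fin d → ℝ}
    (hp : AffineIndependent ℝ p) : liftDet p ≠ 0 := by
  intro h
  obtain ⟨v, hv, hv0⟩ := Matrix.exists_mulVec_eq_zero_iff.2 h
  have hrow := fun j => congrFun hv0 j
  simp only [Matrix.mulVec, dotProduct, Matrix.of_apply, Pi.zero_apply] at hrow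
  refine hv (funext fun i => affineIndependent_iff.1 hp Finset.univ v ?_ ?_ i (Finset.mem_univ i))
  · simpa using hrow (Fin.last d)
  · ext j
    simpa [mul_comm] using hrow (Fin.castSucc j)

theorem exists_liftDet_ne_zero_of_affineSpan_eq_top {A : Set (Fin d → ℝ)}
    (hA : affineSpan ℝ A = ⊤) :
    ∃ p : Fin (d + 1) → A, liftDet (fun i => (p i : Fin d → ℝ)) ≠ 0 := by
  obtain ⟨t, htA, ht, hind⟩ := exists_affineIndependent ℝ (Fin d → ℝ) A
  have := finite_of_fin_dim_affineIndependent ℝ hind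
  have := Fintype.ofFinite t
  have hcard : Fintype.card t = d + 1 := by
    simpa using hind.affineSpan_eq_top_iff_card_eq_finrank_add_one.1 (by simpa [ht] using hA)
  let e := (Fintype.equivFinOfCardEq hcard).symm
  exact ⟨fun i => ⟨e i, htA (e i).2⟩, (hind.comp_embedding e.toEmbedding).liftDet_ne_zero⟩

theorem det_rankOneSum_homogenize {ι : Type*} [Fintype ι] (a b : ι → Fin d → ℝ) (c : ι → ℝ) :
    ((d + 1).factorial : ℝ) *
        (rankOneSum (fun i => homogenize (a i)) (fun i => homogenize (b i)) c).det =
      ∑ p : Fin (d + 1) → ι,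
        (∏ i, c (p i)) * (liftDet (fun i => a (p i)) * liftDet (fun i => b (p i))) := by
  let M : Matrix (Fin (d + 1)) ι ℝ := Matrix.of fun j i => c i * homogenize (a i) j
  let N : Matrix ι (Fin (d + 1)) ℝ := Matrix.of fun i j => homogenize (b i) j
  have hdet : (rankOneSum (fun i => homogenize (a i)) (fun i => homogenize (b i)) c).det =
      (M * N).det := by
    let e := (EuclideanSpace.basisFun (Fin (d + 1)) ℝ).toBasis
    rw [ContinuousLinearMap.det, ← LinearMap.det_toMatrix e]
    congr 1
    ext i j
    simp [LinearMap.toMatrix_apply, e, rankOneSum_apply, Matrix.mul_apply, M, N]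
    refine Finset.sum_congr rfl fun k _ => ?_
    rw [EuclideanSpace.inner_single_right]
    simp
    ring
  have hCB := Matrix.factorial_card_mul_det_mul M N
  rw [Fintype.card_fin] at hCB
  rw [hdet, hCB]
  refine Finset.sum_congr rfl fun p _ => ?_
  have hM : (M.submatrix id p).det = (∏ i, c (p i)) * liftDet (fun i => a (p i)) :=
    Matrix.det_mul_row (fun i => c (p i)) _
  have hN : (N.submatrix p id).det = liftDet (fun i => b (p i)) := by
    rw [← Matrix.det_transpose]
    rfl
  rw [hM, hN, mul_assoc]

theorem liftDet_eq_zero_of_not_injective {p : Fin (d + 1) → Fin d → ℝ}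
    (hp : ¬ Function.Injective p) : liftDet p = 0 := by
  obtain ⟨i, j, hij, hne⟩ := Function.not_injective_iff.1 hp
  exact Matrix.det_zero_of_column_eq hne fun k => by simp [hij]

theorem OrderTypeReversingOn.liftDet_mul_neg {γ : (Fin d → ℝ) → (Fin d → ℝ)}
    {A : Set (Fin d → ℝ)} (h : OrderTypeReversingOn γ A) {p : Fin (d + 1) → Fin d → ℝ}
    (hp : ∀ i, p i ∈ A) (h0 : liftDet p ≠ 0) : liftDet p * liftDet (γ ∘ p) < 0 := by
  have hinj : Function.Injective p := not_not.1 (mt liftDet_eq_zero_of_not_injective h0)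
  have hs := h p hp hinj
  have h0' : liftDet (γ ∘ p) ≠ 0 := fun h' => h0 <| by
    rwa [h', Real.sign_zero, neg_zero, Real.sign_eq_zero_iff] at hs
  have h1 := Real.sign_mul_pos_of_ne_zero _ h0
  have h2 := Real.sign_mul_pos_of_ne_zero _ h0'
  rw [hs] at h1
  rcases Real.sign_apply_eq_of_ne_zero _ h0' with h3 | h3 <;> rw [h3] at h1 h2 <;> nlinarith

theorem OrderTypeReversingOn.det_rankOneSum_neg {γ : (Fin d → ℝ) → (Fin d → ℝ)}
    {A : Set (Fin d → ℝ)} [Fintype A] (h : OrderTypeReversingOn γ A) (hA : affineSpan ℝ A = ⊤)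
    {c : A → ℝ} (hc : ∀ i, 0 < c i) :
    (rankOneSum (fun i : A => homogenize (i : Fin d → ℝ)) (fun i => homogenize (γ i)) c).det
      < 0 := by
  obtain ⟨q, hq⟩ := exists_liftDet_ne_zero_of_affineSpan_eq_top hA
  refine neg_of_mul_neg_right (a := ((d + 1).factorial : ℝ)) ?_ (by positivity)
  rw [det_rankOneSum_homogenize]
  refine Finset.sum_neg' (fun p _ => ?_) ⟨q, Finset.mem_univ q, ?_⟩
  · refine mul_nonpos_of_nonneg_of_nonpos (Finset.prod_nonneg fun i _ => (hc _).le) ?_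
    by_cases h0 : liftDet (fun i => (p i : Fin d → ℝ)) = 0
    · simp [h0]
    · exact (h.liftDet_mul_neg (fun i => (p i).2) h0).le
  · exact mul_neg_of_pos_of_neg (Finset.prod_pos fun i _ => hc _)
      (h.liftDet_mul_neg (fun i => (q i).2) hq)

/-- A linear functional takes on `[x, y]` every value weakly between its values at `x` and `y`. -/
theorem exists_mem_segment_of_mul_nonpos {V : Type*} [AddCommGroup V] [Module ℝ V]
    (f : V →ₗ[ℝ] ℝ) (c : ℝ) {x y : V} (h : (f x - c) * (f y - c) ≤ 0) :
    ∃ z ∈ segment ℝ x y, f z = c := by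
  have himg : f '' segment ℝ x y = segment ℝ (f x) (f y) := image_segment ℝ f.toAffineMap x y
  have : c ∈ segment ℝ (f x) (f y) := by
    rw [segment_eq_uIcc, Set.mem_uIcc]
    rcases mul_nonpos_iff.1 h with h | h
    · right; constructor <;> linarith
    · left; constructor <;> linarith
  rwa [← himg] at this

end Lift

/-- **Cutting finite order-type reversed point sets.** If `A` and `B` are finite point sets
affinely spanning ℝ^d and `γ` is an order-type reversing bijection from `A` to `B`, then
some affine hyperplane meets every segment `[a, γ a]` with `a ∈ A`. -/
theorem cutting_ordertypes_finite {d : ℕ} (A B : Finset (Fin d → ℝ))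
    (hA : affineSpan ℝ (A : Set (Fin d → ℝ)) = ⊤)
    (hB : affineSpan ℝ (B : Set (Fin d → ℝ)) = ⊤)
    (γ : (Fin d → ℝ) → (Fin d → ℝ))
    (hγ : Set.BijOn γ (A : Set (Fin d → ℝ)) (B : Set (Fin d → ℝ)))
    (hrev : OrderTypeReversingOn γ (A : Set (Fin d → ℝ))) :
    ∃ H : Set (Fin d → ℝ), IsAffHyperplane H ∧
      ∀ a ∈ A, (segment ℝ a (γ a) ∩ H).Nonempty := by
  obtain ⟨w, hw, hsep⟩ := exists_ne_zero_forall_inner_mul_inner_nonpos _ _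
    fun _ hc => hrev.det_rankOneSum_neg hA hc
  simp only [inner_homogenize] at hsep
  let u : Fin d → ℝ := fun j => w (Fin.castSucc j)
  let f : (Fin d → ℝ) →ₗ[ℝ] ℝ := dotProductBilin ℝ ℝ u
  have hu : u ≠ 0 := by
    intro hu
    obtain ⟨a, ha⟩ : (A : Set (Fin d → ℝ)).Nonempty := by
      rw [← affineSpan_nonempty ℝ, hA]
      exact univ_nonempty
    have hu' : ∀ j, w (Fin.castSucc j) = 0 := fun j => congrFun hu j
    have h0 : w (Fin.last d) = 0 := by
      have h := hsep ⟨a, ha⟩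
      simp only [hu', zero_mul, Finset.sum_const_zero, zero_add] at h
      exact mul_self_eq_zero.1 (h.antisymm (mul_self_nonneg _))
    refine hw ?_
    ext j
    refine Fin.lastCases ?_ (fun j => ?_) j
    · simpa using h0
    · simpa using hu' j
  refine ⟨{x | ∑ j, u j * x j = -w (Fin.last d)}, ⟨u, _, hu, rfl⟩, fun a ha => ?_⟩
  refine exists_mem_segment_of_mul_nonpos f (-w (Fin.last d)) ?_
  rw [sub_neg_eq_add, sub_neg_eq_add]
  exact hsep ⟨a, ha⟩
end
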